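/- arXiv:2112.15223 — 5 statements merged into one kernel-verified Lean document; each statement's English description precedes it below -/
import Mathlib

section
/- Let M be a positive integer, ν ≥ 0 an integer, f : ℤ → ℂ an M-periodic function, and α ∈ ℚ. Suppose mean(f_{α/M}) = 0, where f_{α/M}(n) := f(n) e^{iπ n² α/M} is an M_α-periodic function with M_α := lcm(M, 2·den(α/M)). Then the nontangential limit Θ^{nt}(α; ν, f, M) := lim_{τ →nt α} Θ(τ; ν, f, M) exists and equals L(-ν, f_{α/M}). -/
open Complex Filter

/-- The partial theta series `Θ(τ; ν, f, M) = Σ_{n≥1} n^ν f(n) e^{iπn²τ/M}`. -/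
noncomputable def theta (M : ℕ) (ν : ℕ) (f : ℤ → ℂ) (τ : ℂ) : ℂ :=
  ∑' n : ℕ, ((n : ℂ) + 1) ^ ν * f (n + 1) *
    Complex.exp (Real.pi * Complex.I * ((n : ℂ) + 1) ^ 2 * τ / M)

/-- `L(-m, g)` for a `P`-periodic `g`, via Bernoulli polynomials. -/
noncomputable def Lval (P : ℕ) (g : ℤ → ℂ) (m : ℕ) : ℂ :=
  -((P : ℂ) ^ m / (m + 1)) * ∑ ℓ ∈ Finset.Icc 1 P,
    g ℓ * (((Polynomial.bernoulli (m + 1)).eval ((ℓ : ℚ) / P) : ℚ) : ℂ)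

/-- The nontangential approach region at `α`: `ε ≤ arg(τ - α) ≤ π - ε`. -/
noncomputable def ntSector (α : ℂ) (ε : ℝ) : Set ℂ :=
  {τ : ℂ | ε ≤ (τ - α).arg ∧ (τ - α).arg ≤ Real.pi - ε}

open Polynomial (aeval)

/-- The shift operator `(E u)(n) = u(n + 1)` on complex sequences. -/
noncomputable def seqShift : Module.End ℂ (ℕ → ℂ) := LinearMap.funLeft ℂ ℂ (fun n => n + 1)

lemma seqShift_apply (u : ℕ → ℂ) (n : ℕ) : seqShift u n = u (n + 1) := rfl

lemma seqShift_pow_apply (k : ℕ) (u : ℕ → ℂ) (n : ℕ) : (seqShift ^ k) u n = u (n + k) := by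
  induction k generalizing u with
  | zero => simp
  | succ k ih => rw [pow_succ, Module.End.mul_apply, ih, seqShift_apply, add_assoc]

/-- Summation over a window of length `P`. -/
noncomputable def windowSum (P : ℕ) : Module.End ℂ (ℕ → ℂ) :=
  aeval seqShift (∑ i ∈ Finset.range P, (Polynomial.X : Polynomial ℂ) ^ i)

lemma windowSum_apply (P : ℕ) (u : ℕ → ℂ) (n : ℕ) :
    windowSum P u n = ∑ i ∈ Finset.range P, u (n + i) := by
  simp [windowSum, LinearMap.sum_apply, Finset.sum_apply, seqShift_pow_apply]

lemma commute_aeval_seqShift (p q : Polynomial ℂ) :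
    Commute (aeval seqShift p) (aeval seqShift q) := by
  rw [Commute, SemiconjBy, ← map_mul, ← map_mul, mul_comm]

/-- On the kernel of a power of `windowSum P` there is an antidifference operator which is a
polynomial in the shift. -/
lemma exists_antidifference (P : ℕ) (hP : 0 < P) (m : ℕ) :
    ∃ R : Polynomial ℂ, ∀ u : ℕ → ℂ, (windowSum P ^ m) u = 0 →
      ∀ n, aeval seqShift R u n - aeval seqShift R u (n + 1) = u n := by
  set s : Polynomial ℂ := (∑ i ∈ Finset.range P, (Polynomial.X : Polynomial ℂ) ^ i) with hs
  obtain ⟨R, hR⟩ := Polynomial.X_sub_C_dvd_sub_C_eval (a := (1 : ℂ)) (p := s ^ m)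
  have he : (s ^ m).eval 1 = (P : ℂ) ^ m := by simp [hs, Polynomial.eval_finsetSum]
  have hP0 : (P : ℂ) ^ m ≠ 0 := pow_ne_zero _ (Nat.cast_ne_zero.2 hP.ne')
  rw [he] at hR
  refine ⟨Polynomial.C (((P : ℂ) ^ m)⁻¹) * R, fun u hu n => ?_⟩
  have h1 := congrArg (fun q => aeval seqShift q u n) hR
  have h2 : aeval seqShift (s ^ m) u = 0 := by rw [map_pow]; exact hu
  simp only [map_sub, map_mul, LinearMap.sub_apply, h2, Module.End.mul_apply, Polynomial.aeval_X,
    Polynomial.aeval_C, Module.algebraMap_end_apply, Pi.sub_apply, Pi.zero_apply, Pi.smul_apply,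
    seqShift_apply, smul_eq_mul, one_mul] at h1 ⊢
  field_simp
  linear_combination h1

/-- Sequences of growth at most `n ^ D`. -/
def PolyGrowth (D : ℕ) (u : ℕ → ℂ) : Prop := ∃ C : ℝ, ∀ n : ℕ, ‖u n‖ ≤ C * ((n : ℝ) + 1) ^ D

lemma PolyGrowth.add {D : ℕ} {u v : ℕ → ℂ} (hu : PolyGrowth D u) (hv : PolyGrowth D v) :
    PolyGrowth D (u + v) := by
  obtain ⟨A, hA⟩ := hu
  obtain ⟨B, hB⟩ := hv
  refine ⟨A + B, fun n => (norm_add_le _ _).trans ?_⟩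
  rw [add_mul]
  exact add_le_add (hA n) (hB n)

lemma PolyGrowth.const_smul {D : ℕ} {u : ℕ → ℂ} (hu : PolyGrowth D u) (c : ℂ) :
    PolyGrowth D (c • u) := by
  obtain ⟨A, hA⟩ := hu
  refine ⟨‖c‖ * A, fun n => ?_⟩
  rw [Pi.smul_apply, norm_smul, mul_assoc]
  exact mul_le_mul_of_nonneg_left (hA n) (norm_nonneg _)

lemma PolyGrowth.seqShift_pow {D : ℕ} {u : ℕ → ℂ} (hu : PolyGrowth D u) (k : ℕ) :
    PolyGrowth D ((seqShift ^ k) u) := by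
  obtain ⟨A, hA⟩ := hu
  have hA0 : 0 ≤ A := by simpa using (norm_nonneg _).trans (hA 0)
  refine ⟨A * ((k : ℝ) + 1) ^ D, fun n => ?_⟩
  rw [seqShift_pow_apply, mul_assoc, ← mul_pow]
  refine (hA _).trans ?_
  push_cast
  have : (n : ℝ) + k + 1 ≤ (k + 1) * (n + 1) := by 
    have : (0 : ℝ) ≤ k * n := by positivity
    linarith
  gcongr

lemma PolyGrowth.aeval {D : ℕ} {u : ℕ → ℂ} (hu : PolyGrowth D u) (p : Polynomial ℂ) :
    PolyGrowth D (aeval seqShift p u) := by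
  induction p using Polynomial.induction_on' with
  | add p q hp hq => simpa using hp.add hq
  | monomial k c =>
    rw [Polynomial.aeval_monomial, Module.End.mul_apply, Module.algebraMap_end_apply]
    exact (hu.seqShift_pow k).const_smul c

/-- A mean-zero periodic sequence times a polynomial sequence is killed by a power of
`windowSum P`. -/
lemma windowSum_pow_mul_eq_zero (P d : ℕ) (h b : ℕ → ℂ) (hper : ∀ n, h (n + P) = h n)
    (hmean : ∑ i ∈ Finset.range P, h i = 0) (hb : ((seqShift - 1) ^ d) b = 0) :
    (windowSum P ^ d) (h * b) = 0 := by
  induction d generalizing h b with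
  | zero =>
    have : b = 0 := by simpa using hb
    simp [this]
  | succ d ih =>
    have hwin : ∀ n, ∑ i ∈ Finset.range P, h (n + i) = 0 := by
      intro n
      induction n with
      | zero => simpa using hmean
      | succ n ihn =>
        have h1 := Finset.sum_range_succ' (fun i => h (n + i)) P
        rw [Finset.sum_range_succ, ihn, hper] at h1
        simp only [add_zero, zero_add] at h1
        have h2 : ∑ i ∈ Finset.range P, h (n + 1 + i) = ∑ i ∈ Finset.range P, h (n + (i + 1)) :=
          Finset.sum_congr rfl fun i _ => by rw [add_assoc, add_comm 1 i]
        rw [h2]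
        linear_combination -h1
    have key : windowSum P (h * b) =
        ∑ i ∈ Finset.range P, ((seqShift ^ i) h) * ((seqShift ^ i - 1) b) := by
      ext n
      rw [windowSum_apply, Finset.sum_apply]
      have : ∑ i ∈ Finset.range P, h (n + i) * b n = 0 := by
        rw [← Finset.sum_mul, hwin, zero_mul]
      rw [← sub_zero (∑ i ∈ Finset.range P, (h * b) (n + i)), ← this, ← Finset.sum_sub_distrib]
      refine Finset.sum_congr rfl fun i _ => ?_
      simp only [Pi.mul_apply, seqShift_pow_apply, LinearMap.sub_apply, Pi.sub_apply,
        Module.End.one_apply]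
      ring
    rw [pow_succ, Module.End.mul_apply, key, map_sum]
    refine Finset.sum_eq_zero fun i _ => ih _ _ ?_ ?_ ?_
    · intro n
      rw [seqShift_pow_apply, seqShift_pow_apply, ← hper (n + i), add_right_comm]
    · rw [← hwin i]
      exact Finset.sum_congr rfl fun j _ => by rw [seqShift_pow_apply, add_comm]
    · have hc : (seqShift - 1) ^ d * (seqShift ^ i - 1) =
          (∑ j ∈ Finset.range i, seqShift ^ j) * (seqShift - 1) ^ (d + 1) := by
        rw [← geom_sum_mul, pow_succ', ← mul_assoc, ← mul_assoc]
        have : Commute (((∑ j ∈ Finset.range i, seqShift ^ j) * (seqShift - 1)))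
            ((seqShift - 1) ^ d) := by
          refine Commute.pow_right (Commute.sub_right ?_ (Commute.one_right _)) d
          refine Commute.mul_left (Commute.sum_left _ _ _ fun j _ => ?_) ?_
          · exact (Commute.refl _).pow_left j
          · exact Commute.sub_left (Commute.refl _) (Commute.one_left _)
        exact this.eq.symm
      rw [← Module.End.mul_apply, hc, Module.End.mul_apply, hb, map_zero]

lemma seqShift_sub_one_pow_eval (p : Polynomial ℂ) :
    ((seqShift - 1) ^ (p.natDegree + 1)) (fun n : ℕ => p.eval (n : ℂ)) = 0 := by
  have : ∀ d : ℕ, ∀ f : ℂ → ℂ, ((seqShift - 1) ^ d) (fun n : ℕ => f n) =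
      fun n : ℕ => (fwdDiff 1)^[d] f n := by
    intro d
    induction d with
    | zero => intro f; simp
    | succ d ih =>
      intro f
      rw [pow_succ, Module.End.mul_apply, Function.iterate_succ_apply, ← ih]
      congr 1
      ext n
      simp [seqShift_apply, fwdDiff]
  rw [this _ fun x => p.eval x, Polynomial.fwdDiff_iter_degree_add_one_eq_zero]
  rfl

lemma PolyGrowth.of_periodic_mul_eval (P : ℕ) (hP : 0 < P) (h : ℕ → ℂ)
    (hper : ∀ n, h (n + P) = h n) (p : Polynomial ℂ) :
    PolyGrowth p.natDegree (h * fun n : ℕ => p.eval (n : ℂ)) := by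
  have hbd : ∃ A : ℝ, ∀ n, ‖h n‖ ≤ A := by
    refine ⟨∑ i ∈ Finset.range P, ‖h i‖, fun n => ?_⟩
    have hp : Function.Periodic h P := hper
    rw [← hp.map_mod_nat n]
    exact Finset.single_le_sum (f := fun i => ‖h i‖) (fun i _ => norm_nonneg _)
      (Finset.mem_range.2 (Nat.mod_lt _ hP))
  obtain ⟨A, hA⟩ := hbd
  refine ⟨A * ∑ i ∈ Finset.range (p.natDegree + 1), ‖p.coeff i‖, fun n => ?_⟩
  have hA0 : 0 ≤ A := (norm_nonneg _).trans (hA 0)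
  rw [Pi.mul_apply, norm_mul, mul_assoc]
  refine mul_le_mul (hA n) ?_ (norm_nonneg _) hA0
  rw [Polynomial.eval_eq_sum_range, Finset.sum_mul]
  refine (norm_sum_le _ _).trans (Finset.sum_le_sum fun i hi => ?_)
  rw [norm_mul, norm_pow, Complex.norm_natCast]
  have hi' : i ≤ p.natDegree := Nat.lt_succ_iff.1 (Finset.mem_range.1 hi)
  refine mul_le_mul_of_nonneg_left ?_ (norm_nonneg _)
  calc (n : ℝ) ^ i ≤ ((n : ℝ) + 1) ^ i := by gcongr; linarith
    _ ≤ _ := pow_le_pow_right₀ (by linarith [Nat.cast_nonneg (α := ℝ) n]) hi'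

/-- Partial summation against a sequence `u = U - E U`. -/
lemma tsum_mul_eq_of_antidifference {u U : ℕ → ℂ} (φ : ℂ → ℂ)
    (hU : ∀ n, U n - U (n + 1) = u n)
    (h0 : Summable fun n : ℕ => U n * φ n) (h1 : Summable fun n : ℕ => U (n + 1) * φ n) :
    ∑' n : ℕ, u n * φ n = U 0 * φ 0 + ∑' n : ℕ, U (n + 1) * fwdDiff 1 φ n := by
  have h2 : Summable fun n : ℕ => U (n + 1) * φ ((n : ℂ) + 1) := by
    have := (summable_nat_add_iff 1).2 h0
    simpa using this
  have e0 : ∑' n : ℕ, U n * φ n = U 0 * φ 0 + ∑' n : ℕ, U (n + 1) * φ ((n : ℂ) + 1) := by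
    rw [h0.tsum_eq_zero_add]; simp
  have e1 : ∑' n : ℕ, u n * φ n = ∑' n : ℕ, U n * φ n - ∑' n : ℕ, U (n + 1) * φ n := by
    rw [← h0.tsum_sub h1]
    exact tsum_congr fun n => by rw [← hU]; ring
  have e2 : ∑' n : ℕ, U (n + 1) * fwdDiff 1 φ n =
      ∑' n : ℕ, U (n + 1) * φ ((n : ℂ) + 1) - ∑' n : ℕ, U (n + 1) * φ n := by
    rw [← h2.tsum_sub h1]
    exact tsum_congr fun n => by rw [fwdDiff]; ring
  rw [e1, e2, e0]; ring

/-- Rapid decrease along the natural numbers. -/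
def RapidDecrease (φ : ℂ → ℂ) : Prop :=
  ∀ D : ℕ, Summable fun n : ℕ => ((n : ℝ) + 1) ^ D * ‖φ n‖

lemma RapidDecrease.fwdDiff {φ : ℂ → ℂ} (h : RapidDecrease φ) : RapidDecrease (fwdDiff 1 φ) := by
  intro D
  have h1 := (summable_nat_add_iff 1).2 (h D)
  refine Summable.of_nonneg_of_le (fun n => by positivity) (fun n => ?_) (h1.add (h D))
  push_cast
  calc ((n : ℝ) + 1) ^ D * ‖φ ((n : ℂ) + 1) - φ n‖
      ≤ ((n : ℝ) + 1) ^ D * (‖φ ((n : ℂ) + 1)‖ + ‖φ n‖) := by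
        gcongr; exact norm_sub_le _ _
    _ = ((n : ℝ) + 1) ^ D * ‖φ ((n : ℂ) + 1)‖ + ((n : ℝ) + 1) ^ D * ‖φ n‖ := by ring
    _ ≤ _ := by gcongr; linarith

lemma RapidDecrease.fwdDiff_iterate {φ : ℂ → ℂ} (h : RapidDecrease φ) (k : ℕ) :
    RapidDecrease ((_root_.fwdDiff 1)^[k] φ) := by
  induction k with
  | zero => exact h
  | succ k ih => rw [Function.iterate_succ_apply']; exact ih.fwdDiff

lemma RapidDecrease.summable_mul {φ : ℂ → ℂ} (h : RapidDecrease φ) {D : ℕ} {u : ℕ → ℂ}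
    (hu : PolyGrowth D u) : Summable fun n : ℕ => u n * φ n := by
  obtain ⟨A, hA⟩ := hu
  refine Summable.of_norm_bounded ((h D).mul_left A) fun n => ?_
  rw [norm_mul, ← mul_assoc]
  exact mul_le_mul_of_nonneg_right (hA n) (norm_nonneg _)

/-- Cauchy estimate for iterated differences of an entire function. -/
lemma norm_fwdDiff_iterate_le (k : ℕ) {φ : ℂ → ℂ} (hφ : Differentiable ℂ φ) (x : ℂ) {B r : ℝ}
    (hr : 0 < r) (hB : ∀ ζ, ‖ζ - x‖ ≤ k * (r + 1) → ‖φ ζ‖ ≤ B) :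
    ‖(fwdDiff 1)^[k] φ x‖ ≤ B / r ^ k := by
  induction k generalizing φ B with
  | zero => simpa using hB x (by simp)
  | succ k ih =>
    rw [Function.iterate_succ_apply, pow_succ', ← div_div]
    refine ih ?_ fun ζ hζ => ?_
    · exact (hφ.comp (differentiable_id.add_const 1)).sub hφ
    · have hderiv : ∀ y ∈ segment ℝ ζ (ζ + 1), ‖deriv φ y‖ ≤ B / r := by
        intro y hy
        refine Complex.norm_deriv_le_of_forall_mem_sphere_norm_le hr hφ.diffContOnCl fun w hw => ?_
        refine hB w ?_
        have h1 : ‖w - y‖ = r := by simpa using hw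
        have h2 : ‖y - ζ‖ ≤ 1 := by
          have := norm_sub_le_of_mem_segment hy
          simpa using this
        calc ‖w - x‖ = ‖(w - y) + (y - ζ) + (ζ - x)‖ := by congr 1; ring
          _ ≤ ‖w - y‖ + ‖y - ζ‖ + ‖ζ - x‖ := norm_add₃_le
          _ ≤ r + 1 + k * (r + 1) := by rw [h1]; gcongr
          _ = _ := by push_cast; ring
      have := (convex_segment (𝕜 := ℝ) ζ (ζ + 1)).norm_image_sub_le_of_norm_deriv_le
        (f := φ) (fun y _ => hφ y) hderiv (left_mem_segment ℝ _ _) (right_mem_segment ℝ _ _)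
      simpa [fwdDiff] using this

/-- The Gaussian weight `e^{-(x+1)²z}`. -/
noncomputable def gaussWeight (z x : ℂ) : ℂ := Complex.exp (-((x + 1) ^ 2 * z))

lemma differentiable_gaussWeight (z : ℂ) : Differentiable ℂ (gaussWeight z) := by
  unfold gaussWeight; fun_prop

/-- The sector in which `Re z` controls `|z|`. -/
def rightSector (c : ℝ) : Set ℂ := {z | c * ‖z‖ ≤ z.re ∧ z ≠ 0}

lemma exp_neg_le_factorial_div {t : ℝ} (ht : 0 < t) (m : ℕ) :
    Real.exp (-t) ≤ m.factorial / t ^ m := by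
  have h := Real.pow_div_factorial_le_exp t ht.le m
  rw [Real.exp_neg, ← inv_div]
  exact inv_anti₀ (by positivity) h

lemma summable_one_div_succ_sq : Summable fun n : ℕ => 1 / ((n : ℝ) + 1) ^ 2 := by
  have := (summable_nat_add_iff 1).2 (Real.summable_one_div_nat_pow.2 (one_lt_two))
  simpa using this

lemma rapidDecrease_gaussWeight {z : ℂ} (hz : 0 < z.re) : RapidDecrease (gaussWeight z) := by
  intro D
  refine Summable.of_nonneg_of_le (fun n => by positivity) (fun n => ?_)
    (summable_one_div_succ_sq.mul_left ((D + 1).factorial / z.re ^ (D + 1)))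
  have hn : (1 : ℝ) ≤ (n : ℝ) + 1 := by linarith [Nat.cast_nonneg (α := ℝ) n]
  have h1 : ‖gaussWeight z n‖ = Real.exp (-(((n : ℝ) + 1) ^ 2 * z.re)) := by
    rw [gaussWeight, Complex.norm_exp, Complex.neg_re]
    have : ((n : ℂ) + 1) ^ 2 = (((n : ℝ) + 1) ^ 2 : ℝ) := by push_cast; ring
    rw [this, Complex.re_ofReal_mul]
  rw [h1]
  have h2 := exp_neg_le_factorial_div (t := ((n : ℝ) + 1) ^ 2 * z.re) (by positivity) (D + 1)
  calc ((n : ℝ) + 1) ^ D * Real.exp (-(((n : ℝ) + 1) ^ 2 * z.re))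
      ≤ ((n : ℝ) + 1) ^ D * ((D + 1).factorial / (((n : ℝ) + 1) ^ 2 * z.re) ^ (D + 1)) := by gcongr
    _ = (D + 1).factorial / z.re ^ (D + 1) * (1 / ((n : ℝ) + 1) ^ (D + 2)) := by
        rw [mul_pow, ← pow_mul]
        field_simp
        ring
    _ ≤ _ := by gcongr; omega

/-- Uniform bound for a high difference of the Gaussian weight in a sector. -/
lemma norm_fwdDiff_gaussWeight_le {c : ℝ} (hc : 0 < c) (D : ℕ) :
    ∃ C : ℝ, ∀ z ∈ rightSector c, ‖z‖ ≤ 1 → ∀ n : ℕ,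
      ‖(fwdDiff 1)^[2 * D + 5] (gaussWeight z) n‖ ≤ C * √‖z‖ / ((n : ℝ) + 1) ^ (2 * D + 4) := by
  set K : ℕ := 2 * D + 5 with hK
  set A : ℝ := 8 * K ^ 2 / c + 4 * K ^ 2 with hA
  refine ⟨Real.exp A * ((D + 2).factorial / (c / 2) ^ (D + 2)), fun z hz hz1 n => ?_⟩
  have hz0 : 0 < ‖z‖ := norm_pos_iff.2 hz.2
  set q : ℝ := √‖z‖ with hq
  have hq0 : 0 < q := Real.sqrt_pos.2 hz0
  have hq1 : q ≤ 1 := Real.sqrt_le_one.2 hz1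
  have hqq : ‖z‖ = q ^ 2 := (Real.sq_sqrt hz0.le).symm
  set x : ℝ := (n : ℝ) + 1 with hx
  have hx0 : 0 < x := by positivity
  have hr1 : 1 ≤ q⁻¹ := (one_le_inv₀ hq0).2 hq1
  have hmain := norm_fwdDiff_iterate_le K (differentiable_gaussWeight z) (n : ℂ)
    (B := Real.exp (A - c / 2 * (x * q) ^ 2)) (r := q⁻¹) (by positivity) ?_
  · refine hmain.trans ?_
    have h2 := exp_neg_le_factorial_div (t := c / 2 * (x * q) ^ 2) (by positivity) (D + 2)
    calc Real.exp (A - c / 2 * (x * q) ^ 2) / q⁻¹ ^ K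
        = Real.exp A * Real.exp (-(c / 2 * (x * q) ^ 2)) * q ^ K := by
          rw [sub_eq_add_neg, Real.exp_add, inv_pow, div_inv_eq_mul]
      _ ≤ Real.exp A * ((D + 2).factorial / (c / 2 * (x * q) ^ 2) ^ (D + 2)) * q ^ K := by gcongr
      _ = _ := by
          rw [hK]
          field_simp
          ring_nf
  · intro ζ hζ
    set η : ℂ := ζ - n with hη
    have hηq : ‖η‖ * q ≤ 2 * K := by
      have : ‖η‖ ≤ K * (2 * q⁻¹) := hζ.trans (by gcongr; linarith)
      calc ‖η‖ * q ≤ K * (2 * q⁻¹) * q := by gcongr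
        _ = 2 * K := by field_simp
    have hexp : (ζ + 1) ^ 2 * z = ((x ^ 2 : ℝ) : ℂ) * z + (2 * x * η * z + η ^ 2 * z) := by
      have : ζ + 1 = x + η := by rw [hη, hx]; push_cast; ring
      rw [this]; push_cast; ring
    rw [gaussWeight, Complex.norm_exp, hexp, Complex.neg_re, Complex.add_re, Complex.re_ofReal_mul]
    refine Real.exp_le_exp.2 ?_
    have h1 : -(2 * x * η * z + η ^ 2 * z).re ≤ 2 * (x * q) * (2 * K) + (2 * K) ^ 2 := by
      calc -(2 * x * η * z + η ^ 2 * z).re ≤ ‖2 * x * η * z + η ^ 2 * z‖ :=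
            (neg_le_abs _).trans (Complex.abs_re_le_norm _)
        _ ≤ ‖2 * x * η * z‖ + ‖η ^ 2 * z‖ := norm_add_le _ _
        _ = 2 * (x * q) * (‖η‖ * q) + (‖η‖ * q) ^ 2 := by
            simp only [norm_mul, norm_pow, hqq, Complex.norm_real, Real.norm_eq_abs,
              abs_of_pos hx0, Complex.norm_ofNat]
            ring
        _ ≤ _ := by gcongr
    have h2 : x ^ 2 * (c * q ^ 2) ≤ x ^ 2 * z.re := by
      have := hz.1
      rw [hqq] at this
      gcongr
    have h3 : 4 * K * (x * q) ≤ c / 2 * (x * q) ^ 2 + 8 * K ^ 2 / c := by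
      have : 0 ≤ c / 2 * (x * q - 4 * K / c) ^ 2 := by positivity
      have e : c / 2 * (x * q - 4 * K / c) ^ 2 =
          c / 2 * (x * q) ^ 2 - 4 * K * (x * q) + 8 * K ^ 2 / c := by
        field_simp; ring
      linarith
    rw [hA]
    nlinarith

lemma tendsto_fwdDiff_gaussWeight (k : ℕ) (x : ℂ) :
    Tendsto (fun z => (fwdDiff 1)^[k + 1] (gaussWeight z) x) (nhds 0) (nhds 0) := by
  have h : ∀ z, (fwdDiff 1)^[k + 1] (gaussWeight z) x = ∑ j ∈ Finset.range (k + 1 + 1),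
      ((-1 : ℤ) ^ (k + 1 - j) * (k + 1).choose j) • gaussWeight z (x + j • 1) := fun z =>
    fwdDiff_iter_eq_sum_shift _ _ _ _
  have hc : Continuous fun z => (fwdDiff 1)^[k + 1] (gaussWeight z) x := by
    simp_rw [h, gaussWeight]
    fun_prop
  have h0 : (fwdDiff 1)^[k + 1] (gaussWeight 0) x = 0 := by
    have : gaussWeight 0 = fun _ => 1 := by ext; simp [gaussWeight]
    rw [this, Function.iterate_succ_apply, fwdDiff_const]
    clear h hc this
    induction k with
    | zero => rfl
    | succ k ih => rw [Function.iterate_succ_apply, fwdDiff_const]; exact ih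
  simpa [h0] using hc.tendsto 0

lemma tendsto_tsum_fwdDiff_high {c : ℝ} (hc : 0 < c) (D : ℕ) {v : ℕ → ℂ} (hv : PolyGrowth D v) :
    Tendsto (fun z => ∑' n : ℕ, v n * (fwdDiff 1)^[2 * D + 5] (gaussWeight z) n)
      (nhdsWithin 0 (rightSector c)) (nhds 0) := by
  obtain ⟨C, hC⟩ := norm_fwdDiff_gaussWeight_le hc D
  obtain ⟨A, hA⟩ := hv
  have hA0 : 0 ≤ A := by simpa using (norm_nonneg _).trans (hA 0)
  have hbound : ∀ z ∈ rightSector c, ‖z‖ ≤ 1 →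
      ‖∑' n : ℕ, v n * (fwdDiff 1)^[2 * D + 5] (gaussWeight z) n‖ ≤
        A * |C| * √‖z‖ * ∑' n : ℕ, 1 / ((n : ℝ) + 1) ^ 2 := by
    intro z hz hz1
    rw [← tsum_mul_left]
    refine tsum_of_norm_bounded (summable_one_div_succ_sq.mul_left _).hasSum fun n => ?_
    have hn : (1 : ℝ) ≤ (n : ℝ) + 1 := by linarith [Nat.cast_nonneg (α := ℝ) n]
    rw [norm_mul]
    calc ‖v n‖ * ‖(fwdDiff 1)^[2 * D + 5] (gaussWeight z) n‖
        ≤ (A * ((n : ℝ) + 1) ^ D) * (C * √‖z‖ / ((n : ℝ) + 1) ^ (2 * D + 4)) :=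
          mul_le_mul (hA n) (hC z hz hz1 n) (norm_nonneg _) (by positivity)
      _ ≤ (A * ((n : ℝ) + 1) ^ D) * (|C| * √‖z‖ / ((n : ℝ) + 1) ^ (2 * D + 4)) := by
          gcongr
          exact le_abs_self C
      _ = A * |C| * √‖z‖ * (1 / ((n : ℝ) + 1) ^ (D + 4)) := by
          field_simp
          ring
      _ ≤ _ := by gcongr; omega
  have hlim : Tendsto (fun z : ℂ => A * |C| * √‖z‖ * ∑' n : ℕ, 1 / ((n : ℝ) + 1) ^ 2)
      (nhdsWithin 0 (rightSector c)) (nhds 0) := by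
    have : Continuous fun z : ℂ => A * |C| * √‖z‖ * ∑' n : ℕ, 1 / ((n : ℝ) + 1) ^ 2 := by
      fun_prop
    simpa using (this.tendsto 0).mono_left nhdsWithin_le_nhds
  refine squeeze_zero_norm' ?_ hlim
  have hball : ∀ᶠ z : ℂ in nhdsWithin 0 (rightSector c), ‖z‖ ≤ 1 := by
    refine nhdsWithin_le_nhds ?_
    filter_upwards [Metric.closedBall_mem_nhds (0 : ℂ) one_pos] with z hz
    simpa using hz
  filter_upwards [self_mem_nhdsWithin, hball] with z hz hz1
  exact hbound z hz hz1

lemma re_pos_of_mem_rightSector {c : ℝ} (hc : 0 < c) {z : ℂ} (hz : z ∈ rightSector c) :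
    0 < z.re :=
  (mul_pos hc (norm_pos_iff.2 hz.2)).trans_le hz.1

lemma tendsto_tsum_fwdDiff {c : ℝ} (hc : 0 < c) {P : ℕ} (hP : 0 < P) (m D : ℕ) (j : ℕ) :
    ∀ k, k + 1 + j = 2 * D + 5 → ∀ v : ℕ → ℂ, PolyGrowth D v → (windowSum P ^ m) v = 0 →
    Tendsto (fun z => ∑' n : ℕ, v n * (fwdDiff 1)^[k + 1] (gaussWeight z) n)
      (nhdsWithin 0 (rightSector c)) (nhds 0) := by
  obtain ⟨R, hR⟩ := exists_antidifference P hP m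
  induction j with
  | zero =>
    intro k hk v hv _
    rw [show k + 1 = 2 * D + 5 from hk]
    exact tendsto_tsum_fwdDiff_high hc D hv
  | succ j ih =>
    intro k hk v hv hker
    set U := aeval seqShift R v with hU
    have hUg : PolyGrowth D U := hv.aeval R
    have hEUg : PolyGrowth D (seqShift U) := by simpa using hUg.seqShift_pow 1
    have hEUker : (windowSum P ^ m) (seqShift U) = 0 := by
      have hcomm : windowSum P ^ m * (seqShift * aeval seqShift R) =
          (seqShift * aeval seqShift R) * windowSum P ^ m := by
        rw [windowSum, ← map_pow]
        have : seqShift * aeval seqShift R = aeval seqShift (Polynomial.X * R) := by simp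
        rw [this]
        exact (commute_aeval_seqShift _ _).eq
      have := congrArg (fun T => T v) hcomm
      simp only [Module.End.mul_apply, hker, map_zero] at this
      exact this
    have h1 := ih (k + 1) (by omega) (seqShift U) hEUg hEUker
    have h2 := ((tendsto_fwdDiff_gaussWeight k 0).const_mul (U 0)).mono_left
      (nhdsWithin_le_nhds (s := rightSector c))
    have h3 := h2.add h1
    simp only [mul_zero, add_zero] at h3
    refine h3.congr' ?_
    filter_upwards [self_mem_nhdsWithin] with z hz
    have hrap := (rapidDecrease_gaussWeight (re_pos_of_mem_rightSector hc hz)).fwdDiff_iterate (k + 1)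
    rw [tsum_mul_eq_of_antidifference _ (hR v hker) (hrap.summable_mul hUg)
      (hrap.summable_mul hEUg)]
    rw [Function.iterate_succ_apply' _ (k + 1)]
    rfl

/-- If `F` is an antidifference of `u`, of polynomial growth and killed by a power of
`windowSum P`, then `∑ u(n) e^{-(n+1)²z}` tends to `F 0` as `z → 0` in a sector. -/
lemma tendsto_tsum_gaussWeight {c : ℝ} (hc : 0 < c) {P : ℕ} (hP : 0 < P) {m D : ℕ}
    {u F : ℕ → ℂ} (hF : ∀ n, F n - F (n + 1) = u n) (hFg : PolyGrowth D F)
    (hFker : (windowSum P ^ m) F = 0) :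
    Tendsto (fun z => ∑' n : ℕ, u n * gaussWeight z n)
      (nhdsWithin 0 (rightSector c)) (nhds (F 0)) := by
  have hEFg : PolyGrowth D (seqShift F) := by simpa using hFg.seqShift_pow 1
  have hEFker : (windowSum P ^ m) (seqShift F) = 0 := by
    have hcomm : windowSum P ^ m * seqShift = seqShift * windowSum P ^ m := by
      rw [windowSum, ← map_pow]
      have := (commute_aeval_seqShift
        ((∑ i ∈ Finset.range P, (Polynomial.X : Polynomial ℂ) ^ i) ^ m) Polynomial.X).eq
      rwa [Polynomial.aeval_X] at this
    have := congrArg (fun T => T F) hcomm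
    simp only [Module.End.mul_apply, hFker, map_zero] at this
    exact this
  have h1 := tendsto_tsum_fwdDiff hc hP m D (2 * D + 4) 0 (by omega) (seqShift F) hEFg hEFker
  have h2 : Tendsto (fun z => F 0 * gaussWeight z 0) (nhdsWithin 0 (rightSector c))
      (nhds (F 0)) := by
    have : Continuous fun z => F 0 * gaussWeight z 0 := by unfold gaussWeight; fun_prop
    simpa [gaussWeight] using (this.tendsto 0).mono_left nhdsWithin_le_nhds
  have h3 := h2.add h1
  rw [add_zero] at h3
  refine h3.congr' ?_
  filter_upwards [self_mem_nhdsWithin] with z hz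
  have hrap := rapidDecrease_gaussWeight (re_pos_of_mem_rightSector hc hz)
  rw [tsum_mul_eq_of_antidifference _ hF (hrap.summable_mul hFg) (hrap.summable_mul hEFg)]
  rfl

/-- The Bernoulli tail sum of `∑ g(n+1)(n+1)^ν` starting at index `n`. -/
lemma exists_bernoulli_antidifference {P : ℕ} (hP : 0 < P) (ν : ℕ) (g : ℤ → ℂ)
    (hper : ∀ n, g (n + P) = g n) (hmean : ∑ n ∈ Finset.range P, g n = 0) :
    ∃ (m D : ℕ) (F : ℕ → ℂ), PolyGrowth D F ∧ (windowSum P ^ m) F = 0 ∧ F 0 = Lval P g ν ∧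
      ∀ n : ℕ, F n - F (n + 1) = ((n : ℂ) + 1) ^ ν * g (n + 1) := by
  have hP0 : (P : ℂ) ≠ 0 := Nat.cast_ne_zero.2 hP.ne'
  have hν0 : (ν : ℂ) + 1 ≠ 0 := Nat.cast_add_one_ne_zero ν
  set h : ℕ → ℂ := fun n => g (n + 1) with hh
  set p : Polynomial ℂ := ((Polynomial.bernoulli (ν + 1)).map (algebraMap ℚ ℂ)).comp
    (Polynomial.C ((P : ℂ)⁻¹) * (Polynomial.X + 1)) with hp
  set b : ℕ → ℂ := fun n => p.eval (n : ℂ) with hb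
  have hbval : ∀ n, b n = (((Polynomial.bernoulli (ν + 1)).eval (((n + 1 : ℕ) : ℚ) / P) : ℚ) : ℂ) := by
    intro n
    have h1 : (P : ℂ)⁻¹ * ((n : ℂ) + 1) = algebraMap ℚ ℂ (((n + 1 : ℕ) : ℚ) / P) := by
      simp [div_eq_inv_mul]
    simp only [hb, hp, Polynomial.eval_comp, Polynomial.eval_mul, Polynomial.eval_C,
      Polynomial.eval_add, Polynomial.eval_X, Polynomial.eval_one]
    rw [h1, Polynomial.eval_map_apply]
    rfl
  have hhper : ∀ n, h (n + P) = h n := by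
    intro n
    simp only [hh]
    rw [← hper (n + 1)]
    congr 1
    push_cast
    ring
  have hhmean : ∑ i ∈ Finset.range P, h i = 0 := by
    have h1 := Finset.sum_range_succ' (fun i : ℕ => g i) P
    rw [Finset.sum_range_succ, hmean] at h1
    have h2 := hper 0
    simp only [zero_add, Nat.cast_zero, Nat.cast_add, Nat.cast_one] at h1 h2
    rw [h2] at h1
    simpa [hh] using h1
  have hbstep : ∀ n, b (n + P) = b n + (ν + 1) * (((n : ℂ) + 1) / P) ^ ν := by
    intro n
    rw [hbval, hbval]
    have h1 : ((n + P + 1 : ℕ) : ℚ) / P = 1 + ((n + 1 : ℕ) : ℚ) / P := by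
      have : (P : ℚ) ≠ 0 := Nat.cast_ne_zero.2 hP.ne'
      field_simp
      push_cast
      ring
    rw [h1, Polynomial.bernoulli_eval_one_add]
    push_cast
    simp
  have hker := windowSum_pow_mul_eq_zero P (p.natDegree + 1) h b hhper hhmean
    (seqShift_sub_one_pow_eval p)
  have hgrow : PolyGrowth p.natDegree (h * b) := PolyGrowth.of_periodic_mul_eval P hP h hhper p
  refine ⟨p.natDegree + 1, p.natDegree, (-((P : ℂ) ^ ν / (ν + 1))) • windowSum P (h * b),
    (hgrow.aeval _).const_smul _, ?_, ?_, fun n => ?_⟩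
  · rw [map_smul, ← Module.End.mul_apply, ← pow_succ, pow_succ', Module.End.mul_apply, hker,
      map_zero, smul_zero]
  · rw [Pi.smul_apply, windowSum_apply, Lval, smul_eq_mul]
    congr 1
    rw [Finset.range_eq_Ico, ← Finset.Ico_succ_right_eq_Icc]
    have h1 := Finset.sum_Ico_add' (fun ℓ : ℕ => g ℓ *
      (((Polynomial.bernoulli (ν + 1)).eval ((ℓ : ℚ) / P) : ℚ) : ℂ)) 0 P 1
    rw [zero_add] at h1
    refine Eq.trans (Finset.sum_congr rfl fun i _ => ?_) h1
    rw [Pi.mul_apply, hbval, zero_add]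
    simp [hh]
  · have h1 : ∑ i ∈ Finset.range P, (h * b) (n + (i + 1)) + (h * b) (n + 0) =
        ∑ i ∈ Finset.range P, (h * b) (n + i) + (h * b) (n + P) := by
      rw [← Finset.sum_range_succ (fun i => (h * b) (n + i)), Finset.sum_range_succ']
    have h2 : ∑ i ∈ Finset.range P, (h * b) (n + 1 + i) =
        ∑ i ∈ Finset.range P, (h * b) (n + (i + 1)) :=
      Finset.sum_congr rfl fun i _ => by rw [add_assoc, add_comm 1 i]
    have h3 : (h * b) (n + P) = (h * b) n + h n * ((ν + 1) * (((n : ℂ) + 1) / P) ^ ν) := by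
      rw [Pi.mul_apply, Pi.mul_apply, hhper, hbstep]; ring
    rw [Pi.smul_apply, Pi.smul_apply, windowSum_apply, windowSum_apply, h2, smul_eq_mul,
      smul_eq_mul, ← mul_sub]
    have h4 : ∑ i ∈ Finset.range P, (h * b) (n + i) -
        ∑ i ∈ Finset.range P, (h * b) (n + (i + 1)) =
        -(h n * ((ν + 1) * (((n : ℂ) + 1) / P) ^ ν)) := by
      rw [add_zero, h3] at h1
      linear_combination -h1
    rw [h4, div_pow]
    simp only [hh]
    field_simp

/-- `n ↦ e^{iπn²β}` has period `P` when `2 den(β)` divides `P`. -/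
lemma exp_sq_periodic (β : ℚ) {P : ℕ} (hP : 2 * β.den ∣ P) (n : ℤ) :
    Complex.exp (Real.pi * Complex.I * ((n + P : ℤ) : ℂ) ^ 2 * β) =
      Complex.exp (Real.pi * Complex.I * (n : ℂ) ^ 2 * β) := by
  obtain ⟨k, rfl⟩ := hP
  rw [Complex.exp_eq_exp_iff_exists_int]
  refine ⟨2 * n * k * β.num + 2 * k ^ 2 * β.den * β.num, ?_⟩
  have hd : (β.den : ℂ) ≠ 0 := Nat.cast_ne_zero.2 β.den_nz
  have hβ : (β : ℂ) = β.num / β.den := Rat.cast_def β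
  rw [hβ]
  push_cast
  field_simp
  ring

/-- If `α ∈ ℚ` and the twisted function `f_{α/M}(n) = f(n)e^{iπn²α/M}`
(which is `M_α`-periodic, `M_α = lcm(M, 2·den(α/M))`) has zero mean, then the nontangential
limit `Θ^{nt}(α; ν, f, M)` exists and equals `L(-ν, f_{α/M})`. -/
theorem statement7 (M : ℕ) (hM : 0 < M) (ν : ℕ) (f : ℤ → ℂ)
    (hf : ∀ n : ℤ, f (n + M) = f n) (α : ℚ)
    (Mα : ℕ) (hMα : Mα = Nat.lcm M (2 * (α / (M : ℚ)).den))
    (g : ℤ → ℂ)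
    (hg : ∀ n : ℤ, g n = f n *
      Complex.exp (Real.pi * Complex.I * (n : ℂ) ^ 2 * (α : ℂ) / (M : ℂ)))
    (hmean : ∑ n ∈ Finset.range Mα, g n = 0) :
    ∀ ε : ℝ, 0 < ε → ε < Real.pi / 2 →
      Filter.Tendsto (theta M ν f) (nhdsWithin (α : ℂ) (ntSector (α : ℂ) ε))
        (nhds (Lval Mα g ν)) := by

  intro ε hε0 hε
  have hM0 : (M : ℂ) ≠ 0 := Nat.cast_ne_zero.2 hM.ne'
  have hMR : (0 : ℝ) < M := Nat.cast_pos.2 hM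
  have hP : 0 < Mα := by
    rw [hMα]
    exact Nat.lcm_pos hM (Nat.mul_pos two_pos (Rat.den_pos _))
  have hfper : ∀ (k : ℕ) (n : ℤ), f (n + (M * k : ℕ)) = f n := by
    intro k n
    have h : Function.Periodic f (M : ℤ) := hf
    have := h.nat_mul k n
    rw [← this]
    congr 2
    push_cast
    ring
  have hgper : ∀ n, g (n + Mα) = g n := by
    intro n
    have hdvd1 : M ∣ Mα := hMα ▸ Nat.dvd_lcm_left _ _
    have hdvd2 : 2 * (α / (M : ℚ)).den ∣ Mα := hMα ▸ Nat.dvd_lcm_right _ _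
    have h1 : f (n + Mα) = f n := by
      obtain ⟨k, hk⟩ := hdvd1
      rw [hk]
      exact hfper k n
    have h2 := exp_sq_periodic (α / (M : ℚ)) hdvd2 n
    push_cast [← mul_div_assoc] at h2
    rw [hg, hg, h1]
    push_cast
    rw [h2]
  obtain ⟨m, D, F, hFg, hFker, hF0, hF⟩ := exists_bernoulli_antidifference hP ν g hgper hmean
  have hs : 0 < Real.sin ε := Real.sin_pos_of_pos_of_lt_pi hε0 (by linarith)
  have key := tendsto_tsum_gaussWeight hs hP hF hFg hFker
  rw [hF0] at key
  set ζ : ℂ → ℂ := fun τ => -(Real.pi * Complex.I * (τ - α) / M) with hζ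
  have hlim : Tendsto ζ (nhdsWithin (α : ℂ) (ntSector (α : ℂ) ε))
      (nhdsWithin 0 (rightSector (Real.sin ε))) := by
    refine tendsto_nhdsWithin_iff.2 ⟨?_, ?_⟩
    · have hc : Continuous ζ := by rw [hζ]; fun_prop
      have h0 : ζ α = 0 := by simp [hζ]
      exact h0 ▸ (hc.tendsto (α : ℂ)).mono_left nhdsWithin_le_nhds
    · filter_upwards [self_mem_nhdsWithin] with τ hτ
      obtain ⟨h1, h2⟩ := hτ
      have hne : τ - α ≠ 0 := by
        intro h
        rw [h, Complex.arg_zero] at h1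
        linarith
      have hsin : Real.sin ε ≤ Real.sin (τ - α).arg := by
        rcases le_total (τ - α).arg (Real.pi / 2) with h | h
        · exact Real.sin_le_sin_of_le_of_le_pi_div_two (by linarith) h h1
        · rw [← Real.sin_pi_sub (τ - α).arg]
          exact Real.sin_le_sin_of_le_of_le_pi_div_two (by linarith) (by linarith) (by linarith)
      have him : Real.sin ε * ‖τ - α‖ ≤ (τ - α).im := by
        rw [← Complex.norm_mul_sin_arg (τ - α), mul_comm]
        gcongr
      have hform : ζ τ = ((Real.pi / M : ℝ) : ℂ) * (-Complex.I * (τ - α)) := by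
        simp only [hζ]; push_cast; ring
      refine ⟨?_, ?_⟩
      · rw [hform, Complex.re_ofReal_mul, norm_mul, norm_mul, norm_neg, Complex.norm_I, one_mul,
          Complex.norm_real, Real.norm_of_nonneg (by positivity)]
        have : (-Complex.I * (τ - α)).re = (τ - α).im := by simp
        rw [this, mul_left_comm]
        gcongr
      · rw [hform]
        have : (Real.pi / M : ℝ) ≠ 0 := by positivity
        simp [hne, hM.ne', Real.pi_ne_zero]
  refine (key.comp hlim).congr fun τ => ?_
  rw [theta, Function.comp_apply]
  refine tsum_congr fun n => ?_
  rw [hg, gaussWeight, mul_assoc, mul_assoc (f _), ← Complex.exp_add, ← mul_assoc]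
  congr 2
  simp only [hζ]
  push_cast
  field_simp
  ring
end

section
/- Let M be a positive integer, f : ℤ → ℂ an M-periodic function, and α ∈ ℚ*. Then (1/M_α) Σ_{n mod M_α} f(n) e^{iπ n² α/M} = (iα)^{1/2} · (1/M') Σ_{n mod M'} (U_M f)(n) e^{-iπ n²/(α M)}, where M_α := lcm(M, 2·den(α/M)) is a period of n ↦ f(n) e^{iπ n² α/M}, M' := lcm(M, 2·den(1/(αM))) is a period of n ↦ (U_M f)(n) e^{-iπ n²/(αM)}, and (iα)^{1/2} is the principal square root. Equivalently, mean(f_{α/M}) = (iα)^{1/2} · mean((U_M f)_{-1/(αM)}). In particular, mean(f_{α/M}) = 0 if and only if mean((U_M f)_{(-1/α)/M}) = 0. -/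
open Complex

/-- The discrete Fourier transform `U_M f` of an `M`-periodic function `f : ℤ → ℂ`. -/
noncomputable def dft (M : ℕ) (f : ℤ → ℂ) (n : ℤ) : ℂ :=
  (Real.sqrt M : ℂ)⁻¹ * ∑ ℓ ∈ Finset.range M, f ℓ *
    Complex.exp (-2 * Real.pi * Complex.I * ℓ * n / M)

open Filter Topology

/-- The Gaussian-weighted series `∑ g(n) e^{-π n² t}`. -/
noncomputable def thetaSeries (g : ℤ → ℂ) (t : ℂ) : ℂ :=
  ∑' n : ℤ, g n * exp (-Real.pi * (n : ℂ) ^ 2 * t)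

/-- A positive real factor can be pulled out of a complex power. -/
theorem ofReal_mul_cpow_of_pos {r : ℝ} (hr : 0 < r) {z : ℂ} (hz : z ≠ 0) (s : ℂ) :
    ((r : ℂ) * z) ^ s = (r : ℂ) ^ s * z ^ s := by
  have hr' : (r : ℂ) ≠ 0 := by exact_mod_cast hr.ne'
  rw [cpow_def_of_ne_zero (mul_ne_zero hr' hz), cpow_def_of_ne_zero hr', cpow_def_of_ne_zero hz,
    log_ofReal_mul hr hz, ofReal_log hr.le, add_mul, Complex.exp_add]

theorem Function.Periodic.norm_le_sum_range {g : ℤ → ℂ} {P : ℕ} (hP : 0 < P)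
    (hg : Function.Periodic g (P : ℤ)) (n : ℤ) :
    ‖g n‖ ≤ ∑ a ∈ Finset.range P, ‖g a‖ := by
  have hP' : (P : ℤ) ≠ 0 := by exact_mod_cast hP.ne'
  obtain ⟨a, ha⟩ := Int.eq_ofNat_of_zero_le (Int.emod_nonneg n hP')
  have haP : a < P := by
    have := Int.emod_lt_of_pos n (show (0 : ℤ) < P by exact_mod_cast hP)
    omega
  have hga : g n = g a := by
    rw [← ha, ← hg.int_mul (n / P) (n % P)]
    congr 1
    rw [mul_comm]
    exact (Int.emod_add_mul_ediv n P).symm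
  rw [hga]
  exact Finset.single_le_sum (f := fun a : ℕ => ‖g a‖) (fun _ _ => norm_nonneg _)
    (Finset.mem_range.2 haP)

theorem summable_thetaSeries {g : ℤ → ℂ} {P : ℕ} (hP : 0 < P)
    (hg : Function.Periodic g (P : ℤ)) {t : ℂ} (ht : 0 < t.re) :
    Summable fun n : ℤ => g n * exp (-Real.pi * (n : ℂ) ^ 2 * t) := by
  have h : Summable (jacobiTheta₂_term · 0 (I * t)) :=
    (summable_jacobiTheta₂_term_iff _ _).2 (by simpa using ht)
  refine (h.norm.mul_left (∑ a ∈ Finset.range P, ‖g a‖)).of_norm_bounded fun n => ?_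
  rw [norm_mul, show exp (-Real.pi * (n : ℂ) ^ 2 * t) = jacobiTheta₂_term n 0 (I * t) by
    rw [jacobiTheta₂_term]
    congr 1
    linear_combination (-Real.pi * (n : ℂ) ^ 2 * t) * I_sq]
  gcongr
  exact hg.norm_le_sum_range hP n

theorem summable_jacobiTheta₂_term_div {P : ℕ} (hP : 0 < P) {t : ℂ} (ht : 0 < t.re) (z : ℂ) :
    Summable (jacobiTheta₂_term · z (I / (P ^ 2 * t))) := by
  rw [summable_jacobiTheta₂_term_iff]
  have : I / (P ^ 2 * t) = ((P ^ 2 : ℝ)⁻¹ : ℝ) * (I * t⁻¹) := by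
    push_cast
    rw [div_eq_mul_inv, mul_inv]
    ring
  rw [this, im_ofReal_mul, I_mul_im, inv_re]
  have : t ≠ 0 := by rintro rfl; simp at ht
  have := normSq_pos.2 this
  positivity

/-- Poisson summation along residue classes for periodic Gaussian series. -/
theorem thetaSeries_eq_sum_jacobiTheta₂ {g : ℤ → ℂ} {P : ℕ} (hP : 0 < P)
    (hg : Function.Periodic g (P : ℤ)) {t : ℂ} (ht : 0 < t.re) :
    thetaSeries g t = (t ^ (1 / 2 : ℂ))⁻¹ * ((P : ℂ)⁻¹ *
      ∑ a ∈ Finset.range P, g a * jacobiTheta₂ (a / P) (I / (P ^ 2 * t))) := by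
  have : NeZero P := ⟨hP.ne'⟩
  have hPC : (P : ℂ) ≠ 0 := by exact_mod_cast hP.ne'
  have ht0 : t ≠ 0 := by rintro rfl; simp at ht
  have hs := (Int.divModEquiv P).symm.summable_iff.2 (summable_thetaSeries hP hg ht)
  have hterm (a : Fin P) (m : ℤ) :
      g (m * P + (a : ℕ)) * exp (-Real.pi * ((m * P + (a : ℕ) : ℤ) : ℂ) ^ 2 * t) =
        g (a : ℕ) * exp (-Real.pi * (a : ℂ) ^ 2 * t) *
          jacobiTheta₂_term m (I * a * P * t) (I * (P ^ 2 * t)) := by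
    have hgm : g (a + m * P) = g a := by simpa using hg.int_mul m a
    rw [add_comm, hgm, mul_assoc (g a), jacobiTheta₂_term, ← Complex.exp_add]
    congr 2
    push_cast
    linear_combination (-2 * Real.pi * m * a * P * t - Real.pi * m ^ 2 * P ^ 2 * t) * I_sq
  have hcpow : ((P : ℂ) ^ 2 * t) ^ (1 / 2 : ℂ) = P * t ^ (1 / 2 : ℂ) := by
    rw [show (P : ℂ) ^ 2 * t = ((P ^ 2 : ℝ) : ℂ) * t by push_cast; rfl,
      ofReal_mul_cpow_of_pos (by positivity) ht0, ofReal_pow, ofReal_natCast,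
      ← cpow_ofNat_mul' (by simp [Real.pi_pos]) (by simp [Real.pi_pos.le])]
    norm_num
  have hfunc (a : Fin P) :
      exp (-Real.pi * (a : ℂ) ^ 2 * t) * jacobiTheta₂ (I * a * P * t) (I * (P ^ 2 * t)) =
        (t ^ (1 / 2 : ℂ))⁻¹ * ((P : ℂ)⁻¹ * jacobiTheta₂ (a / P) (I / (P ^ 2 * t))) := by
    rw [jacobiTheta₂_functional_equation,
      show -I * (I * (P ^ 2 * t)) = P ^ 2 * t by linear_combination (-P ^ 2 * t) * I_sq, hcpow,
      show I * a * P * t / (I * (P ^ 2 * t)) = a / P by field_simp,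
      show -1 / (I * (P ^ 2 * t)) = I / (P ^ 2 * t) by
        field_simp
        exact I_sq.symm,
      show -Real.pi * I * (I * a * P * t) ^ 2 / (I * (P ^ 2 * t)) =
          -(-Real.pi * (a : ℂ) ^ 2 * t) by
        field_simp
        linear_combination (-1 : ℂ) * I_sq * a ^ 2,
      Complex.exp_neg]
    have := Complex.exp_ne_zero (-Real.pi * (a : ℂ) ^ 2 * t)
    field_simp
  rw [thetaSeries, ← (Int.divModEquiv P).symm.tsum_eq,
    ← Function.comp_def (fun n : ℤ => g n * exp (-Real.pi * (n : ℂ) ^ 2 * t)),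
    Summable.tsum_prod' hs fun _ => Summable.of_finite]
  simp only [Function.comp_apply, Int.divModEquiv_symm_apply, tsum_fintype, hterm]
  rw [Summable.tsum_finsetSum]
  · simp only [tsum_mul_left, Finset.sum_range, Finset.mul_sum]
    refine Finset.sum_congr rfl fun a _ => ?_
    change _ * jacobiTheta₂ _ _ = _
    linear_combination g (a : ℕ) * hfunc a
  · refine fun a _ => Summable.mul_left _ ((summable_jacobiTheta₂_term_iff _ _).2 ?_)
    rw [I_mul_im, ← Nat.cast_pow, ← ofReal_natCast, re_ofReal_mul]
    positivity

theorem tendsto_jacobiTheta₂_one {ι : Type*} {l : Filter ι} {τ : ι → ℂ} (x : ℝ)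
    (hτ : Tendsto (fun i => (τ i).im) l atTop) :
    Tendsto (fun i => jacobiTheta₂ x (τ i)) l (𝓝 1) := by
  have hnorm (n : ℤ) (i : ι) : ‖jacobiTheta₂_term n x (τ i)‖ =
      Real.exp (-Real.pi * n ^ 2 * (τ i).im) := by
    simp [norm_jacobiTheta₂_term]
  rw [← tsum_ite_eq (0 : ℤ) (fun _ => (1 : ℂ))]
  refine tendsto_tsum_of_dominated_convergence
    (bound := fun n : ℤ => Real.exp (-Real.pi * n ^ 2 * 1)) ?_ (fun n => ?_) ?_
  · have := ((summable_jacobiTheta₂_term_iff 0 I).2 (by simp)).norm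
    simpa [norm_jacobiTheta₂_term] using this
  · split_ifs with hn
    · simpa [hn, jacobiTheta₂_term] using tendsto_const_nhds
    · rw [tendsto_zero_iff_norm_tendsto_zero]
      simp only [hnorm]
      refine Real.tendsto_exp_atBot.comp (hτ.const_mul_atTop_of_neg ?_)
      have : (n : ℝ) ≠ 0 := by exact_mod_cast hn
      have := sq_pos_of_ne_zero this
      nlinarith [Real.pi_pos]
  · filter_upwards [hτ.eventually_ge_atTop 1] with i hi n
    rw [hnorm, Real.exp_le_exp, neg_mul, neg_mul, neg_mul, neg_le_neg_iff]
    gcongr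

/-- The mean of a periodic function governs its Gaussian series as `1 / t → ∞`. -/
theorem tendsto_thetaSeries_mean {ι : Type*} {l : Filter ι} {g : ℤ → ℂ} {P : ℕ} (hP : 0 < P)
    (hg : Function.Periodic g (P : ℤ)) {t : ι → ℂ}
    (ht : Tendsto (fun i => ((t i)⁻¹).re) l atTop) :
    Tendsto (fun i => t i ^ (1 / 2 : ℂ) * thetaSeries g (t i)) l
      (𝓝 ((P : ℂ)⁻¹ * ∑ a ∈ Finset.range P, g a)) := by
  have him : Tendsto (fun i => (I / (P ^ 2 * t i)).im) l atTop := by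
    have hP2 : (0 : ℝ) < (P ^ 2 : ℝ)⁻¹ := by positivity
    refine (ht.const_mul_atTop hP2).congr fun i => ?_
    rw [show I / (P ^ 2 * t i) = ((P ^ 2 : ℝ)⁻¹ : ℝ) * (I * (t i)⁻¹) by
      push_cast
      rw [div_eq_mul_inv, mul_inv]
      ring, im_ofReal_mul, I_mul_im]
  have hlim : Tendsto (fun i => (P : ℂ)⁻¹ *
      ∑ a ∈ Finset.range P, g a * jacobiTheta₂ (a / P) (I / (P ^ 2 * t i))) l
      (𝓝 ((P : ℂ)⁻¹ * ∑ a ∈ Finset.range P, g a * 1)) := by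
    refine (tendsto_finsetSum _ fun a _ => Tendsto.const_mul _ ?_).const_mul _
    simpa using tendsto_jacobiTheta₂_one ((a : ℝ) / P) him
  simp only [mul_one] at hlim
  refine hlim.congr' ?_
  filter_upwards [ht.eventually_gt_atTop 0] with i hi
  have ht0 : t i ≠ 0 := by
    intro h
    simp [h] at hi
  have hre : 0 < (t i).re := by
    rw [inv_re] at hi
    exact (div_pos_iff_of_pos_right (normSq_pos.2 ht0)).1 hi
  rw [thetaSeries_eq_sum_jacobiTheta₂ hP hg hre, mul_inv_cancel_left₀]
  simp [cpow_eq_zero_iff, ht0]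

/-- Functional equation relating the Gaussian series of `f` and of its discrete Fourier
transform. -/
theorem thetaSeries_dft {M : ℕ} (hM : 0 < M) {f : ℤ → ℂ} (hf : Function.Periodic f (M : ℤ))
    {w : ℂ} (hw : 0 < w.re) :
    thetaSeries f (w / M) = (w ^ (1 / 2 : ℂ))⁻¹ * thetaSeries (dft M f) (M * w)⁻¹ := by
  have hMC : (M : ℂ) ≠ 0 := by exact_mod_cast hM.ne'
  have hMR : (0 : ℝ) < M := by exact_mod_cast hM
  have hw0 : w ≠ 0 := by rintro rfl; simp at hw
  have ht : 0 < (w / M).re := by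
    rw [div_natCast_re]
    positivity
  have hsqrt : (M : ℂ) ^ (1 / 2 : ℂ) = (Real.sqrt M : ℂ) := by
    rw [Real.sqrt_eq_rpow, ofReal_cpow hMR.le]
    push_cast
    rfl
  have hroot : (w / M) ^ (1 / 2 : ℂ) = w ^ (1 / 2 : ℂ) / Real.sqrt M := by
    rw [eq_div_iff (by simp [hM.ne']), ← hsqrt, mul_comm, ← ofReal_natCast,
      ← ofReal_mul_cpow_of_pos hMR, ofReal_natCast, mul_div_cancel₀ _ hMC]
    exact div_ne_zero hw0 hMC
  have hsq : (Real.sqrt M : ℂ) * Real.sqrt M = M := by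
    rw [← ofReal_mul, Real.mul_self_sqrt hMR.le, ofReal_natCast]
  have hsq0 : (Real.sqrt M : ℂ) ≠ 0 := by simp [hM.ne']
  have hτ : I / (M ^ 2 * (w / M)) = I / (M * w) := by field_simp
  have hsum (a : ℕ) : Summable fun m : ℤ =>
      f a * jacobiTheta₂_term m (-(a / M)) (I / (M * w)) :=
    (hτ ▸ summable_jacobiTheta₂_term_div hM ht (-(a / M))).mul_left _
  rw [thetaSeries_eq_sum_jacobiTheta₂ hM hf ht, hroot, hτ]
  have hmain : ∑ a ∈ Finset.range M, f a * jacobiTheta₂ (a / M) (I / (M * w)) =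
      Real.sqrt M * thetaSeries (dft M f) (M * w)⁻¹ := by
    rw [thetaSeries, ← tsum_mul_left]
    simp_rw [← jacobiTheta₂_neg_left (_ / _), jacobiTheta₂, ← tsum_mul_left]
    rw [← Summable.tsum_finsetSum fun a _ => hsum a]
    refine tsum_congr fun n => ?_
    rw [dft, mul_assoc, mul_inv_cancel_left₀ hsq0, Finset.sum_mul]
    refine Finset.sum_congr rfl fun a _ => ?_
    rw [mul_assoc, jacobiTheta₂_term, ← Complex.exp_add]
    congr 2
    field_simp
    linear_combination (n : ℂ) ^ 2 * I_sq
  rw [hmain, inv_div, div_eq_mul_inv]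
  linear_combination (w ^ (1 / 2 : ℂ))⁻¹ * thetaSeries (dft M f) (M * w)⁻¹ *
    ((M : ℂ)⁻¹ * hsq + inv_mul_cancel₀ hMC)

theorem dft_periodic {M : ℕ} (hM : 0 < M) (f : ℤ → ℂ) :
    Function.Periodic (dft M f) (M : ℤ) := by
  have hMC : (M : ℂ) ≠ 0 := by exact_mod_cast hM.ne'
  intro n
  rw [dft, dft]
  congr 1
  refine Finset.sum_congr rfl fun a _ => ?_
  rw [show -2 * Real.pi * I * a * ((n + M : ℤ) : ℂ) / M =
      -2 * Real.pi * I * a * n / M + ((-a : ℤ) : ℂ) * (2 * Real.pi * I) by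
    push_cast
    field_simp
    ring, Complex.exp_add, exp_int_mul_two_pi_mul_I, mul_one]

/-- The chirp `n ↦ e^{iπ n² q}` with `q` rational preserves periodicity. -/
theorem Function.Periodic.mul_exp_sq {f : ℤ → ℂ} {M : ℕ} (hf : Function.Periodic f (M : ℤ))
    (q : ℚ) :
    Function.Periodic (fun n : ℤ => f n * exp (Real.pi * I * (n : ℂ) ^ 2 * q))
      (Nat.lcm M (2 * q.den) : ℕ) := by
  intro n
  obtain ⟨j, hj⟩ := Nat.dvd_lcm_left M (2 * q.den)
  obtain ⟨k, hk⟩ := Nat.dvd_lcm_right M (2 * q.den)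
  have hfn : f (n + (Nat.lcm M (2 * q.den) : ℕ)) = f n := by
    rw [hj, Nat.cast_mul, mul_comm]
    simpa using hf.int_mul j n
  have hd : (q.den : ℂ) ≠ 0 := by exact_mod_cast q.den_nz
  have hq : (q : ℂ) = q.num / q.den := Rat.cast_def q
  simp only [hfn]
  rw [hk, hq, show Real.pi * I * ((n + (2 * q.den * k : ℕ) : ℤ) : ℂ) ^ 2 * (q.num / q.den) =
      Real.pi * I * (n : ℂ) ^ 2 * (q.num / q.den) +
        ((2 * n * k * q.num + 2 * q.den * k ^ 2 * q.num : ℤ) : ℂ) * (2 * Real.pi * I) by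
    push_cast
    field_simp
    ring, Complex.exp_add, exp_int_mul_two_pi_mul_I, mul_one]

theorem inv_cpow_half_neg_I_mul {a : ℝ} (ha : a ≠ 0) :
    ((-I * a) ^ (1 / 2 : ℂ))⁻¹ * (((a * a : ℂ)⁻¹) ^ (1 / 2 : ℂ))⁻¹ = (I * a) ^ (1 / 2 : ℂ) := by
  have haC : (a : ℂ) ≠ 0 := by exact_mod_cast ha
  have hpos : 0 < (a * a)⁻¹ := inv_pos.2 (mul_self_pos.2 ha)
  have hne : (((a * a : ℂ)⁻¹) ^ (1 / 2 : ℂ)) ≠ 0 := by simp [cpow_eq_zero_iff, ha]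
  rw [← inv_cpow _ _ (slitPlane_arg_ne_pi (Or.inr (by simpa using ha))),
    show (-I * a)⁻¹ = (((a * a)⁻¹ : ℝ) : ℂ) * (I * a) by
      push_cast
      field_simp
      linear_combination -I_sq,
    ofReal_mul_cpow_of_pos hpos (mul_ne_zero I_ne_zero haC)]
  push_cast
  field_simp

/-- Comparison of the means of `f(n) e^{iπ n² a/M}` and `(U_M f)(n) e^{-iπ n²/(aM)}`, for any
periods of these two functions. -/
theorem mean_chirp_eq_mean_dft_chirp {M : ℕ} (hM : 0 < M) {f : ℤ → ℂ}
    (hf : Function.Periodic f (M : ℤ)) {a : ℝ} (ha : a ≠ 0) {P Q : ℕ} (hP : 0 < P) (hQ : 0 < Q)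
    (hfP : Function.Periodic (fun n : ℤ => f n * exp (Real.pi * I * (n : ℂ) ^ 2 * a / M)) (P : ℤ))
    (hfQ : Function.Periodic
      (fun n : ℤ => dft M f n * exp (-(Real.pi * I * (n : ℂ) ^ 2) / (a * M))) (Q : ℤ)) :
    (P : ℂ)⁻¹ * ∑ n ∈ Finset.range P, f n * exp (Real.pi * I * (n : ℂ) ^ 2 * a / M) =
      (I * a) ^ (1 / 2 : ℂ) * ((Q : ℂ)⁻¹ * ∑ n ∈ Finset.range Q,
        dft M f n * exp (-(Real.pi * I * (n : ℂ) ^ 2) / (a * M))) := by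
  have hMC : (M : ℂ) ≠ 0 := by exact_mod_cast hM.ne'
  have hMR : (0 : ℝ) < M := by exact_mod_cast hM
  have haC : (a : ℂ) ≠ 0 := by exact_mod_cast ha
  let l : Filter ℝ := 𝓝[>] 0
  let w : ℝ → ℂ := fun ε => ε + -I * a
  let u : ℝ → ℂ := fun ε => (a * (a + I * ε))⁻¹
  have hw0 (ε : ℝ) : w ε ≠ 0 := fun h => ha (by simpa [w] using congrArg im h)
  have hwI (ε : ℝ) : a + I * ε = I * w ε := by
    simp only [w]
    linear_combination (a : ℂ) * I_sq
  have hu0 (ε : ℝ) : u ε ≠ 0 :=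
    inv_ne_zero (mul_ne_zero haC (hwI ε ▸ mul_ne_zero I_ne_zero (hw0 ε)))
  have ht₁ : Tendsto (fun ε : ℝ => (((ε / M : ℝ) : ℂ)⁻¹).re) l atTop := by
    refine (tendsto_inv_nhdsGT_zero.const_mul_atTop hMR).congr fun ε => ?_
    rw [← ofReal_inv, ofReal_re, inv_div, div_eq_mul_inv]
  have ht₂ : Tendsto (fun ε : ℝ => ((((ε / M : ℝ) : ℂ) * u ε)⁻¹).re) l atTop := by
    have hpos : 0 < M * (a * a) := mul_pos hMR (mul_self_pos.2 ha)
    refine (tendsto_inv_nhdsGT_zero.const_mul_atTop hpos).congr fun ε => ?_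
    rw [mul_inv, inv_inv, ← ofReal_inv, re_ofReal_mul, re_ofReal_mul, inv_div]
    simp
    ring
  have h₁ := tendsto_thetaSeries_mean hP hfP ht₁
  have h₂ := tendsto_thetaSeries_mean hQ hfQ ht₂
  have hw : Tendsto (fun ε => (w ε ^ (1 / 2 : ℂ))⁻¹) l (𝓝 ((-I * a) ^ (1 / 2 : ℂ))⁻¹) := by
    have hc : Tendsto w l (𝓝 (-I * a)) := by
      have : Continuous w := by fun_prop
      simpa [w] using (this.tendsto 0).mono_left nhdsWithin_le_nhds
    refine (hc.cpow tendsto_const_nhds (Or.inr (by simpa using ha))).inv₀ ?_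
    simp [cpow_eq_zero_iff, ha]
  have hu : Tendsto (fun ε => (u ε ^ (1 / 2 : ℂ))⁻¹) l (𝓝 (((a * a : ℂ)⁻¹) ^ (1 / 2 : ℂ))⁻¹) := by
    have hc : Tendsto u l (𝓝 (a * a : ℂ)⁻¹) := by
      have : Continuous fun ε : ℝ => (a : ℂ) * (a + I * ε) := by fun_prop
      have h := (this.tendsto 0).mono_left (nhdsWithin_le_nhds (s := Set.Ioi 0))
      simp only [ofReal_zero, mul_zero, add_zero] at h
      exact h.inv₀ (mul_ne_zero haC haC)
    have hpos : 0 < (a * a)⁻¹ := inv_pos.2 (mul_self_pos.2 ha)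
    refine (hc.cpow tendsto_const_nhds (Or.inl ?_)).inv₀ ?_
    · exact_mod_cast hpos
    · simp [cpow_eq_zero_iff, ha]
  have h₃ := (hw.mul hu).mul h₂
  rw [inv_cpow_half_neg_I_mul ha] at h₃
  refine tendsto_nhds_unique h₁ (h₃.congr' ?_)
  filter_upwards [self_mem_nhdsWithin] with ε hε
  replace hε : 0 < ε := hε
  have hleft : thetaSeries (fun n => f n * exp (Real.pi * I * (n : ℂ) ^ 2 * a / M))
      (ε / M : ℝ) = thetaSeries f (w ε / M) := by
    refine tsum_congr fun n => ?_
    rw [mul_assoc, ← Complex.exp_add]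
    congr 2
    simp only [w]
    push_cast
    ring
  have hright : thetaSeries (fun n => dft M f n * exp (-(Real.pi * I * (n : ℂ) ^ 2) / (a * M)))
      ((ε / M : ℝ) * u ε) = thetaSeries (dft M f) (M * w ε)⁻¹ := by
    refine tsum_congr fun n => ?_
    rw [mul_assoc, ← Complex.exp_add]
    congr 2
    have := hw0 ε
    simp only [u, hwI]
    push_cast
    field_simp
    simp only [w]
    linear_combination (n : ℂ) ^ 2 * (I * a - ε) * I_sq
  have hwre : 0 < (w ε).re := by simpa [w] using hε
  have hεM : 0 < ε / M := div_pos hε hMR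
  have hu' : u ε ^ (1 / 2 : ℂ) ≠ 0 := by simp [cpow_eq_zero_iff, hu0]
  rw [hleft, hright, thetaSeries_dft hM hf hwre, ofReal_mul_cpow_of_pos hεM (hu0 ε)]
  field_simp

/-- Quadratic Gauss sum identity: for `α ∈ ℚ*`,
`mean(f_{α/M}) = (iα)^{1/2} · mean((U_M f)_{-1/(αM)})`, where the means are computed over the
periods `M_α = lcm(M, 2·den(α/M))` and `M' = lcm(M, 2·den(1/(αM)))`; in particular one mean
vanishes iff the other does. -/
theorem statement11 (M : ℕ) (hM : 0 < M) (f : ℤ → ℂ)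
    (hf : ∀ n : ℤ, f (n + M) = f n) (α : ℚ) (hα : α ≠ 0)
    (Mα M' : ℕ)
    (hMα : Mα = Nat.lcm M (2 * (α / (M : ℚ)).den))
    (hM' : M' = Nat.lcm M (2 * (1 / (α * (M : ℚ))).den)) :
    ((Mα : ℂ)⁻¹ * ∑ n ∈ Finset.range Mα,
        f n * Complex.exp (Real.pi * Complex.I * (n : ℂ) ^ 2 * (α : ℂ) / (M : ℂ))
      = (Complex.I * (α : ℂ)) ^ ((1 : ℂ) / 2) *
        ((M' : ℂ)⁻¹ * ∑ n ∈ Finset.range M',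
          dft M f n * Complex.exp (-(Real.pi * Complex.I * (n : ℂ) ^ 2) / ((α : ℂ) * (M : ℂ))))) ∧
    ((Mα : ℂ)⁻¹ * ∑ n ∈ Finset.range Mα,
        f n * Complex.exp (Real.pi * Complex.I * (n : ℂ) ^ 2 * (α : ℂ) / (M : ℂ)) = 0 ↔
      (M' : ℂ)⁻¹ * ∑ n ∈ Finset.range M',
        dft M f n * Complex.exp (-(Real.pi * Complex.I * (n : ℂ) ^ 2) / ((α : ℂ) * (M : ℂ))) = 0) := by
  have hf' : Function.Periodic f (M : ℤ) := hf
  have key := mean_chirp_eq_mean_dft_chirp hM hf' (a := (α : ℝ)) (P := Mα) (Q := M')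
    (by exact_mod_cast hα)
    (hMα ▸ Nat.lcm_pos hM (by positivity)) (hM' ▸ Nat.lcm_pos hM (by positivity))
    (by
      convert hf'.mul_exp_sq (α / M) using 4
      push_cast
      ring)
    (by
      convert (dft_periodic hM f).mul_exp_sq (-(1 / (α * M))) using 4
      · push_cast
        ring
      · rw [Rat.neg_den, hM'])
  simp only [ofReal_ratCast] at key
  refine ⟨key, ?_⟩
  rw [key, mul_eq_zero, or_iff_right]
  simp [cpow_eq_zero_iff, hα]
end

section
/- Let M be an even positive integer, f : ℤ → ℂ an even M-periodic function, and γ = (a b; c d) ∈ SL(2, ℤ) with c > 0. Define g(r) := Σ_{ℓ mod cM, ℓ ≡ r mod M} e^{iπ a ℓ²/(cM)} (a sum over the c residues mod cM congruent to r mod M) and h(n) := (cM)^{-1/2} e^{iπ b d n²/M} Σ_{r mod M} f(r + dn) g(r) e^{2πi b n r/M}. Then h is a well-defined even M-periodic function ℤ → ℂ, and for every τ ∈ ℍ: θ(γ(τ); f) = ((cτ+d)/i)^{1/2} · θ(τ; h), where γ(τ) = (aτ+b)/(cτ+d), θ(τ; f) := f(0) + 2Θ(τ; 0, f, M), θ(τ;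 h) := h(0) + 2Θ(τ; 0, h, M), and ((cτ+d)/i)^{1/2} is the principal branch. -/
open Complex

open Finset in
theorem Function.Periodic.sum_range_int_add {N : ℕ} {φ : ℤ → ℂ} (hφ : Function.Periodic φ N)
    (s : ℤ) : ∑ j ∈ range N, φ (j + s) = ∑ j ∈ range N, φ j := by
  have step (t : ℤ) : ∑ j ∈ range N, φ (j + (t + 1)) = ∑ j ∈ range N, φ (j + t) := by
    have h₁ := sum_range_succ (fun j : ℕ => φ (j + t)) N
    have h₂ := sum_range_succ' (fun j : ℕ => φ (j + t)) N
    have h₃ : φ ((N : ℤ) + t) = φ (((0 : ℕ) : ℤ) + t) := by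
      rw [add_comm, hφ t]; simp
    have h₄ : ∀ j : ℕ, φ (((j + 1 : ℕ) : ℤ) + t) = φ (j + (t + 1)) := fun j => by
      congr 1; push_cast; ring
    simp only [h₄] at h₂
    rw [h₁, h₃] at h₂
    exact (add_right_cancel h₂).symm
  induction s using Int.induction_on with
  | zero => simp
  | succ i ih => rw [step, ih]
  | pred i ih => rw [← step, sub_add_cancel, ih]

open Finset in
theorem Function.Periodic.sum_range_int_neg {N : ℕ} {φ : ℤ → ℂ} (hφ : Function.Periodic φ N) :
    ∑ j ∈ range N, φ (-j) = ∑ j ∈ range N, φ j := by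
  rw [← sum_range_reflect (fun j : ℕ => φ (-j)), ← hφ.sum_range_int_add (1 - N)]
  refine sum_congr rfl fun j hj => ?_
  have := mem_range.1 hj
  congr 1
  omega

open Finset in
theorem Finset.sum_range_mul_add (c M : ℕ) (φ : ℤ → ℂ) :
    ∑ r ∈ range M, ∑ j ∈ range c, φ (r + j * M) = ∑ l ∈ range (c * M), φ l := by
  induction c with
  | zero => simp
  | succ c ih =>
    simp only [sum_range_succ, sum_add_distrib, ih, add_mul, one_mul, sum_range_add]
    congr 1
    refine sum_congr rfl fun r _ => ?_
    congr 1
    push_cast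
    ring

theorem Function.Periodic.exists_norm_le_of_int {N : ℕ} (hN : 0 < N) {F : ℤ → ℂ}
    (hF : Function.Periodic F N) : ∃ C, ∀ n, ‖F n‖ ≤ C := by
  refine ⟨∑ r ∈ Finset.range N, ‖F r‖, fun n => ?_⟩
  have hN' : (N : ℤ) ≠ 0 := by positivity
  have h₁ := Int.emod_nonneg n hN'
  have h₂ := Int.emod_lt_of_pos n (by positivity : (0 : ℤ) < N)
  have hmod : F n = F (n % N) := by
    conv_lhs => rw [← Int.emod_add_mul_ediv n N, mul_comm]
    exact hF.int_mul (n / N) (n % N)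
  rw [hmod]
  obtain ⟨k, hk⟩ := Int.eq_ofNat_of_zero_le h₁
  rw [hk] at h₂ ⊢
  exact Finset.single_le_sum (f := fun r : ℕ => ‖F r‖) (fun _ _ => norm_nonneg _)
    (Finset.mem_range.2 (by exact_mod_cast h₂))

theorem Function.Periodic.summable_mul_of_int {N : ℕ} (hN : 0 < N) {F G : ℤ → ℂ}
    (hF : Function.Periodic F N) (hG : Summable G) : Summable fun n => F n * G n := by
  obtain ⟨C, hC⟩ := hF.exists_norm_le_of_int hN
  refine (hG.norm.mul_left C).of_norm_bounded fun n => ?_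
  rw [norm_mul]
  exact mul_le_mul_of_nonneg_right (hC n) (norm_nonneg _)

theorem Function.Periodic.tsum_mul_of_int {N : ℕ} (hN : 0 < N) {F G : ℤ → ℂ}
    (hF : Function.Periodic F N) (hG : Summable G) :
    ∑' n, F n * G n = ∑ l ∈ Finset.range N, F l * ∑' k : ℤ, G (l + k * N) := by
  have : NeZero N := ⟨hN.ne'⟩
  have hs := hF.summable_mul_of_int hN hG
  obtain ⟨e, he⟩ : ∃ e : Fin N × ℤ ≃ ℤ, ∀ p, e p = (p.1 : ℕ) + p.2 * N :=
    ⟨(Equiv.prodComm _ _).trans (Int.divModEquiv N).symm, fun p => add_comm _ _⟩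
  have hs' : Summable fun p : Fin N × ℤ => F (e p) * G (e p) := hs.comp_injective e.injective
  rw [← e.tsum_eq, hs'.tsum_prod, tsum_fintype,
    Finset.sum_range (fun l => F l * ∑' k : ℤ, G (l + k * N))]
  refine Finset.sum_congr rfl fun l _ => ?_
  rw [← tsum_mul_left]
  refine tsum_congr fun k => ?_
  rw [he]
  dsimp only
  congr 1
  exact hF.int_mul k l

theorem summable_cexp_sq {x : ℂ} (hx : 0 < x.im) :
    Summable fun n : ℤ => Complex.exp (Real.pi * I * n ^ 2 * x) :=
  ((summable_jacobiTheta₂_term_iff 0 x).2 hx).congr fun n => by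
    simp [jacobiTheta₂_term]

theorem add_two_mul_theta_zero {M : ℕ} (hM : 0 < M) {f : ℤ → ℂ} (hf : Function.Periodic f M)
    (heven : ∀ n, f (-n) = f n) {τ : ℂ} (hτ : 0 < τ.im) :
    f 0 + 2 * theta M 0 f τ = ∑' n : ℤ, f n * Complex.exp (Real.pi * I * n ^ 2 * (τ / M)) := by
  have hx : 0 < (τ / M).im := by
    rw [div_natCast_im]; positivity
  have hs := hf.summable_mul_of_int hM (summable_cexp_sq hx)
  obtain ⟨G, hG⟩ : ∃ G : ℤ → ℂ, ∀ n, f n * cexp (Real.pi * I * n ^ 2 * (τ / M)) = G n :=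
    ⟨_, fun _ => rfl⟩
  simp only [hG] at hs ⊢
  have h₁ : Function.Injective fun n : ℕ => (n + 1 : ℤ) := fun _ _ h => by simpa using h
  have h₂ : Function.Injective fun n : ℕ => (-(n + 1) : ℤ) := fun _ _ h => by simpa using h
  have e₁ (n : ℕ) : G (n + 1) = ((n : ℂ) + 1) ^ 0 * f (n + 1) *
      cexp (Real.pi * I * ((n : ℂ) + 1) ^ 2 * τ / M) := by
    rw [← hG, pow_zero, one_mul]
    push_cast
    ring_nf
  have e₂ (n : ℤ) : G (-n) = G n := by
    rw [← hG, ← hG, heven]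
    push_cast
    rw [neg_sq]
  have e₀ : G 0 = f 0 := by
    rw [← hG]
    simp
  rw [tsum_of_add_one_of_neg_add_one (hs.comp_injective h₁) (hs.comp_injective h₂), e₀]
  simp only [e₂, e₁, theta]
  ring

theorem Complex.div_I_cpow_half {N : ℕ} (hN : 0 < N) {w : ℂ} (hw : w ≠ 0) :
    (w / I) ^ (1 / 2 : ℂ) = ((√(N : ℝ) : ℝ) : ℂ) * (-I * (w / N)) ^ (1 / 2 : ℂ) := by
  have hN' : (0 : ℝ) < N := by positivity
  have hNC : (N : ℂ) ≠ 0 := by exact_mod_cast hN.ne'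
  have hx : -I * (w / N) ≠ 0 := by simp [hw, hNC]
  have h : w / I = ((N : ℝ) : ℂ) * (-I * (w / N)) := by
    rw [div_I, ofReal_natCast]
    field_simp
  rw [h, cpow_def_of_ne_zero (mul_ne_zero (by simpa using hNC) hx), cpow_def_of_ne_zero hx,
    log_ofReal_mul hN' hx, add_mul, exp_add, Real.sqrt_eq_rpow, ofReal_cpow hN'.le,
    cpow_def_of_ne_zero (by simpa using hNC), ← ofReal_log hN'.le]
  norm_num

theorem tsum_cexp_sq_arithmetic_progression {N : ℕ} (hN : 0 < N) (l : ℤ) {w : ℂ}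
    (hw : 0 < w.im) :
    ∑' k : ℤ, Complex.exp (Real.pi * I * ((l + k * N : ℤ) : ℂ) ^ 2 * (-1 / (N * w))) =
      (w / I) ^ (1 / 2 : ℂ) * ((√(N : ℝ) : ℝ) : ℂ)⁻¹ *
        ∑' m : ℤ, Complex.exp (Real.pi * I * m ^ 2 * (w / N)) *
          Complex.exp (-(2 * Real.pi * I * m * l / N)) := by
  have hw0 : w ≠ 0 := fun h => by simp [h] at hw
  have hNC : (N : ℂ) ≠ 0 := by exact_mod_cast hN.ne'
  have hsq : ((√(N : ℝ) : ℝ) : ℂ) ≠ 0 := by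
    rw [ofReal_ne_zero]; positivity
  have hp : (-I * (w / N)) ^ (1 / 2 : ℂ) ≠ 0 := by
    rw [Ne, cpow_eq_zero_iff]; simp [hw0, hNC]
  have key := jacobiTheta₂_functional_equation (-l / N) (w / N)
  have e₁ : ∑' m : ℤ, Complex.exp (Real.pi * I * m ^ 2 * (w / N)) *
      Complex.exp (-(2 * Real.pi * I * m * l / N)) = jacobiTheta₂ (-l / N) (w / N) := by
    refine tsum_congr fun m => ?_
    rw [jacobiTheta₂_term, ← exp_add]
    congr 1
    ring
  have e₂ : ∑' k : ℤ, Complex.exp (Real.pi * I * ((l + k * N : ℤ) : ℂ) ^ 2 * (-1 / (N * w))) =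
      Complex.exp (-Real.pi * I * (-l / N) ^ 2 / (w / N)) *
        jacobiTheta₂ (-l / N / (w / N)) (-1 / (w / N)) := by
    rw [jacobiTheta₂, ← tsum_mul_left]
    refine tsum_congr fun k => ?_
    rw [jacobiTheta₂_term, ← exp_add]
    congr 1
    push_cast
    field_simp
    ring
  rw [e₁, e₂, key, Complex.div_I_cpow_half hN hw0]
  generalize (-I * (w / N)) ^ (1 / 2 : ℂ) = p at hp ⊢
  field_simp

theorem Function.Periodic.tsum_mul_cexp_sq {N : ℕ} (hN : 0 < N) {F : ℤ → ℂ}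
    (hF : Function.Periodic F N) {w : ℂ} (hw : 0 < w.im) :
    ∑' n : ℤ, F n * Complex.exp (Real.pi * I * n ^ 2 * (-1 / (N * w))) =
      (w / I) ^ (1 / 2 : ℂ) * ∑' m : ℤ, ((√(N : ℝ) : ℝ) : ℂ)⁻¹ *
        (∑ l ∈ Finset.range N, F l * Complex.exp (-(2 * Real.pi * I * m * l / N))) *
          Complex.exp (Real.pi * I * m ^ 2 * (w / N)) := by
  have hw0 : w ≠ 0 := fun h => by simp [h] at hw
  have him : 0 < (-1 / (N * w)).im := by
    have : -1 / (N * w) = -w⁻¹ / N := by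
      have hNC : (N : ℂ) ≠ 0 := by exact_mod_cast hN.ne'
      field_simp
    rw [this, div_natCast_im, neg_im, inv_im]
    have := normSq_pos.2 hw0
    rw [← neg_div, neg_neg]
    positivity
  have him' : 0 < (w / N).im := by
    rw [div_natCast_im]; positivity
  have hs (l : ℕ) : Summable fun m : ℤ => Complex.exp (Real.pi * I * m ^ 2 * (w / N)) *
      Complex.exp (-(2 * Real.pi * I * m * l / N)) := by
    refine ((summable_jacobiTheta₂_term_iff (-l / N) (w / N)).2 him').congr fun m => ?_
    rw [jacobiTheta₂_term, ← exp_add]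
    congr 1
    ring
  rw [hF.tsum_mul_of_int hN (summable_cexp_sq him)]
  simp only [tsum_cexp_sq_arithmetic_progression hN _ hw, Int.cast_natCast, ← tsum_mul_left]
  rw [← Summable.tsum_finsetSum fun l _ => ((hs l).mul_left _).mul_left _]
  refine tsum_congr fun m => ?_
  rw [Finset.mul_sum, Finset.sum_mul, Finset.mul_sum]
  refine Finset.sum_congr rfl fun l _ => ?_
  ring

theorem Complex.exp_eq_of_sub_eq {x y : ℂ} (k : ℤ) (h : x - y = k * (2 * Real.pi * I)) :
    Complex.exp x = Complex.exp y :=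
  exp_eq_exp_iff_exists_int.2 ⟨k, by linear_combination h⟩

/-- For `M` even, `f` even `M`-periodic, and `γ = (a b; c d) ∈ SL(2,ℤ)` with
`c > 0`, the function `h(n) = (cM)^{-1/2} e^{iπbdn²/M} Σ_{r mod M} f(r+dn) g(r) e^{2πibnr/M}`,
with `g(r) = Σ_{ℓ mod cM, ℓ≡r mod M} e^{iπaℓ²/(cM)}`, is well defined, even and `M`-periodic,
and `θ(γ(τ); f) = ((cτ+d)/i)^{1/2} θ(τ; h)` on `ℍ`. -/
theorem statement15 (M : ℕ) (hM : 0 < M) (hMeven : Even M)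
    (f : ℤ → ℂ) (hf : ∀ n : ℤ, f (n + M) = f n) (heven : ∀ n : ℤ, f (-n) = f n)
    (a b d : ℤ) (c : ℕ) (hc : 0 < c) (hdet : a * d - b * (c : ℤ) = 1)
    (g : ℤ → ℂ)
    (hg : ∀ r : ℤ, g r = ∑ j ∈ Finset.range c,
      Complex.exp (Real.pi * Complex.I * (a : ℂ) * ((r : ℂ) + (j : ℂ) * (M : ℂ)) ^ 2 /
        ((c : ℂ) * (M : ℂ))))
    (h : ℤ → ℂ)
    (hh : ∀ n : ℤ, h n = ((Real.sqrt (c * M) : ℝ) : ℂ)⁻¹ *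
      Complex.exp (Real.pi * Complex.I * (b : ℂ) * (d : ℂ) * (n : ℂ) ^ 2 / (M : ℂ)) *
      ∑ r ∈ Finset.range M, f ((r : ℤ) + d * n) * g r *
        Complex.exp (2 * Real.pi * Complex.I * (b : ℂ) * (n : ℂ) * (r : ℂ) / (M : ℂ))) :
    (∀ n : ℤ, h (n + M) = h n) ∧ (∀ n : ℤ, h (-n) = h n) ∧
    ∀ τ : ℂ, 0 < τ.im →
      f 0 + 2 * theta M 0 f (((a : ℂ) * τ + (b : ℂ)) / ((c : ℂ) * τ + (d : ℂ)))
        = (((c : ℂ) * τ + (d : ℂ)) / Complex.I) ^ ((1 : ℂ) / 2) *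
          (h 0 + 2 * theta M 0 h τ) := by
  have hMC : (M : ℂ) ≠ 0 := by exact_mod_cast hM.ne'
  have hcC : (c : ℂ) ≠ 0 := by exact_mod_cast hc.ne'
  have hdetC : (a : ℂ) * d - b * c = 1 := by exact_mod_cast hdet
  have hN : 0 < c * M := Nat.mul_pos hc hM
  have hfp : Function.Periodic f M := hf
  obtain ⟨M', hM'⟩ := hMeven
  have hM'C : (M : ℂ) = M' + M' := by exact_mod_cast hM'
  let F : ℤ → ℂ := fun l => f l * Complex.exp (Real.pi * I * a * l ^ 2 / (c * M))
  have hF : Function.Periodic F ((c * M : ℕ) : ℤ) := fun l => by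
    have h₁ : f (l + ((c * M : ℕ) : ℤ)) = f l := by
      have := hfp.int_mul c l
      push_cast at this ⊢
      exact this
    simp only [F, h₁]
    congr 1
    refine exp_eq_of_sub_eq (a * l + a * c * M') ?_
    push_cast
    field_simp
    rw [hM'C]
    ring
  have hE (m : ℤ) : Function.Periodic (fun l : ℤ => Complex.exp (-(2 * Real.pi * I * m * l / (c * M))))
      ((c * M : ℕ) : ℤ) := fun l => by
    refine exp_eq_of_sub_eq (-m) ?_
    push_cast
    field_simp
    ring
  have hFE (m : ℤ) : Function.Periodic
      (fun l : ℤ => F l * Complex.exp (-(2 * Real.pi * I * m * l / (c * M)))) ((c * M : ℕ) : ℤ) :=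
    hF.mul (hE m)
  have hh' (n : ℤ) : h n = ((Real.sqrt (c * M) : ℝ) : ℂ)⁻¹ *
      Complex.exp (Real.pi * I * d * n ^ 2 / (c * M)) *
      ∑ l ∈ Finset.range (c * M), F l * Complex.exp (-(2 * Real.pi * I * n * l / (c * M))) := by
    have hshift := (hFE n).sum_range_int_add (d * n)
    simp only [Int.cast_natCast] at hshift
    rw [hh, ← hshift, mul_assoc _ (cexp _) (∑ r ∈ Finset.range M, (_ : ℂ)),
      mul_assoc _ (cexp _) (∑ l ∈ Finset.range (c * M), (_ : ℂ)),
      ← Finset.sum_range_mul_add c M (fun l : ℤ =>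
        F (l + d * n) * cexp (-(2 * Real.pi * I * n * ((l + d * n : ℤ) : ℂ) / (c * M))))]
    congr 1
    rw [Finset.mul_sum, Finset.mul_sum]
    refine Finset.sum_congr rfl fun r _ => ?_
    rw [hg, Finset.mul_sum, Finset.sum_mul, Finset.mul_sum, Finset.mul_sum]
    refine Finset.sum_congr rfl fun j _ => ?_
    have h₁ : f ((r : ℤ) + (j : ℤ) * M + d * n) = f (r + d * n) := by
      have := hfp.int_mul j (r + d * n)
      rw [← this]
      congr 1
      rw [Int.cast_id]
      ring
    simp only [F, h₁]
    rw [mul_assoc (f _), mul_assoc (f _), mul_left_comm _ (f _), mul_left_comm _ (f _),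
      ← exp_add, ← exp_add, ← exp_add, ← exp_add]
    congr 1
    refine exp_eq_of_sub_eq (-(b * n * j)) (sub_eq_zero.1 ?_)
    push_cast
    trans (a * d - b * c - 1) * (-(2 * n * (r + j * M) + d * n ^ 2) * (Real.pi * I) / (c * M))
    · field_simp
      ring
    · rw [hdetC, sub_self, zero_mul]
  have hper : Function.Periodic h M := fun n => by
    rw [hh, hh]
    congr 1
    · congr 1
      refine exp_eq_of_sub_eq (b * d * (n + M')) ?_
      push_cast
      field_simp
      rw [hM'C]
      ring
    · refine Finset.sum_congr rfl fun r _ => ?_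
      have h₁ : f (r + d * (n + M)) = f (r + d * n) := by
        have := hfp.int_mul d (r + d * n)
        rw [← this]
        congr 1
        rw [Int.cast_id]
        ring
      rw [h₁]
      congr 1
      refine exp_eq_of_sub_eq (b * r) ?_
      push_cast
      field_simp
      ring
  have hhe (n : ℤ) : h (-n) = h n := by
    have := (hFE n).sum_range_int_neg
    simp only [Int.cast_natCast] at this
    rw [hh', hh', ← this]
    congr 1
    · push_cast
      rw [neg_sq]
    · refine Finset.sum_congr rfl fun l _ => ?_
      simp only [F, heven]
      push_cast
      congr 2
      · rw [neg_sq]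
      · congr 1
        ring
  refine ⟨hper, hhe, fun τ hτ => ?_⟩
  have hw : 0 < ((c : ℂ) * τ + d).im := by
    simp only [add_im, mul_im, natCast_re, natCast_im, zero_mul, intCast_im, add_zero]
    positivity
  set w : ℂ := c * τ + d with hwdef
  have hw0 : w ≠ 0 := fun h => by simp [h] at hw
  have hsplit : (a * τ + b) / w = a / c - w⁻¹ / c := by
    field_simp
    rw [hwdef]
    linear_combination -hdetC
  have hγ : 0 < ((a * τ + b) / w).im := by
    rw [hsplit, sub_im, div_natCast_im, div_natCast_im, inv_im, intCast_im]
    have := normSq_pos.2 hw0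
    have hc' : (0 : ℝ) < c := by exact_mod_cast hc
    rw [zero_div, zero_sub, neg_div, neg_div, neg_neg]
    positivity
  rw [add_two_mul_theta_zero hM hfp heven hγ, add_two_mul_theta_zero hM hper hhe hτ]
  have key := hF.tsum_mul_cexp_sq hN hw
  push_cast at key
  have e₁ : ∑' n : ℤ, f n * Complex.exp (Real.pi * I * n ^ 2 * ((a * τ + b) / w / M)) =
      ∑' n : ℤ, F n * Complex.exp (Real.pi * I * n ^ 2 * (-1 / (c * M * w))) := by
    refine tsum_congr fun n => ?_
    rw [hsplit]
    simp only [F]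
    rw [mul_assoc (f n), ← exp_add]
    congr 2
    field_simp
    ring
  rw [e₁, key]
  congr 1
  refine tsum_congr fun m => ?_
  rw [hh', mul_right_comm _ (cexp _), mul_assoc _ (cexp _) (cexp _), ← exp_add]
  congr 2
  rw [hwdef]
  field_simp
  ring
end

section
/- Let M be an even positive integer, f : ℤ → ℂ an odd M-periodic function, and γ = (a b; c d) ∈ SL(2, ℤ) with c > 0. Define g(r) := Σ_{ℓ mod cM, ℓ ≡ r mod M} e^{iπ a ℓ²/(cM)} and h(n) := (cM)^{-1/2} e^{iπ b d n²/M} Σ_{r mod M} f(r + dn) g(r) e^{2πi b n r/M}. Then h is a well-defined odd M-periodic function ℤ → ℂ, and for every τ ∈ ℍ: Θ(γ(τ); 1, f, M) = i · ((cτ+d)/i)^{3/2} · Θ(τ; 1, h, M), where γ(τ) = (aτ+b)/(cτ+d) and ((cτ+d)/i)^{3/2} is the principal branch. -/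
open Complex

section PartialTheta

open Real HurwitzZeta

lemma Function.Periodic.apply_intEmod {E : Type*} {F : ℤ → E} {N : ℤ}
    (hF : Function.Periodic F N) (n : ℤ) : F (n % N) = F n := by
  conv_rhs => rw [← Int.emod_add_mul_ediv n N, mul_comm]
  exact (hF.int_mul (n / N) (n % N)).symm

lemma Function.Periodic.sum_range_eq_sum_zmod {E : Type*} [AddCommMonoid E] {F : ℤ → E} {N : ℕ}
    [NeZero N] (hF : Function.Periodic F N) (φ : ℤ → ℤ) (e : ZMod N ≃ ZMod N)
    (he : ∀ m : ℤ, ((φ m : ℤ) : ZMod N) = e m) :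
    ∑ m ∈ Finset.range N, F (φ m) = ∑ m ∈ Finset.range N, F m := by
  have key (x : ZMod N) (m : ℤ) (hm : (m : ZMod N) = x) : F x.cast = F m := by
    rw [← hm, ZMod.coe_intCast, hF.apply_intEmod]
  have hsum (ψ : ℤ → E) : ∑ m ∈ Finset.range N, ψ m = ∑ x : ZMod N, ψ x.val := by
    refine Finset.sum_bij' (fun m _ ↦ (m : ZMod N)) (fun x _ ↦ x.val) ?_ ?_ ?_ ?_ ?_
    · simp
    · simp [ZMod.val_lt]
    · intro m hm
      exact ZMod.val_cast_of_lt (Finset.mem_range.mp hm)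
    · simp
    · intro m hm
      rw [ZMod.val_cast_of_lt (Finset.mem_range.mp hm)]
  rw [hsum fun m ↦ F (φ m), hsum, ← e.sum_comp (fun x : ZMod N ↦ F x.val)]
  refine Finset.sum_congr rfl fun x _ ↦ ?_
  rw [← key (e x) _ (by rw [he]; simp), ← key (e x) (e x).val (by simp)]

lemma Function.Periodic.sum_range_add {E : Type*} [AddCommMonoid E] {F : ℤ → E} {N : ℕ}
    (hF : Function.Periodic F N) (k : ℤ) :
    ∑ m ∈ Finset.range N, F (m + k) = ∑ m ∈ Finset.range N, F m := by
  rcases N.eq_zero_or_pos with rfl | hN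
  · simp
  have : NeZero N := ⟨hN.ne'⟩
  exact hF.sum_range_eq_sum_zmod (· + k) (Equiv.addRight (k : ZMod N)) (by simp)

lemma Function.Periodic.sum_range_neg {E : Type*} [AddCommMonoid E] {F : ℤ → E} {N : ℕ}
    (hF : Function.Periodic F N) :
    ∑ m ∈ Finset.range N, F (-m) = ∑ m ∈ Finset.range N, F m := by
  rcases N.eq_zero_or_pos with rfl | hN
  · simp
  have : NeZero N := ⟨hN.ne'⟩
  exact hF.sum_range_eq_sum_zmod (- ·) (Equiv.neg (ZMod N)) (by simp)

lemma Finset.sum_range_mul_eq_sum_sum {E : Type*} [AddCommMonoid E] (G : ℕ → E) (c M : ℕ) :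
    ∑ m ∈ Finset.range (c * M), G m =
      ∑ r ∈ Finset.range M, ∑ j ∈ Finset.range c, G (r + j * M) := by
  rw [Finset.sum_comm]
  induction c with
  | zero => simp
  | succ c ih =>
    rw [Nat.succ_mul, Finset.sum_range_add, ih, Finset.sum_range_succ]
    simp [add_comm]

lemma summable_int_theta {F : ℤ → ℂ} {N : ℕ} (hN : 0 < N) (hF : Function.Periodic F N) {σ : ℂ}
    (hσ : 0 < σ.im) :
    Summable fun n : ℤ ↦ (n : ℂ) * F n * Complex.exp (π * I * (n : ℂ) ^ 2 * σ) := by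
  have h1 := ((summable_jacobiTheta₂'_term_iff 0 σ).mpr hσ).norm.mul_left
    ((2 * π)⁻¹ * ∑ m ∈ Finset.range N, ‖F m‖)
  refine Summable.of_norm_bounded h1 fun n ↦ ?_
  have hb : ‖F n‖ ≤ ∑ m ∈ Finset.range N, ‖F m‖ := by
    have h2 : 0 ≤ n % N := Int.emod_nonneg n (by omega)
    have h3 : n % N < N := Int.emod_lt_of_pos n (by omega)
    obtain ⟨m, hm⟩ := Int.eq_ofNat_of_zero_le h2
    rw [← hF.apply_intEmod, hm]
    exact Finset.single_le_sum (f := fun m : ℕ ↦ ‖F m‖) (fun _ _ ↦ norm_nonneg _)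
      (Finset.mem_range.mpr (by omega))
  simp only [jacobiTheta₂'_term, jacobiTheta₂_term, mul_zero, zero_add, norm_mul, norm_I,
    Complex.norm_real, Complex.norm_ofNat, Real.norm_eq_abs, abs_of_pos pi_pos]
  calc _ = ‖F n‖ * (‖(n : ℂ)‖ * ‖Complex.exp (π * I * (n : ℂ) ^ 2 * σ)‖) := by ring
    _ ≤ (∑ m ∈ Finset.range N, ‖F m‖) * (‖(n : ℂ)‖ * ‖Complex.exp (π * I * (n : ℂ) ^ 2 * σ)‖) := by
      gcongr
    _ = _ := by field_simp

lemma two_mul_theta_one {F : ℤ → ℂ} {N : ℕ} (hN : 0 < N) (hF : Function.Periodic F N)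
    (hodd : ∀ n, F (-n) = -F n) {τ : ℂ} (hτ : 0 < τ.im) :
    2 * theta N 1 F τ = ∑' n : ℤ, (n : ℂ) * F n * Complex.exp (π * I * (n : ℂ) ^ 2 * (τ / N)) := by
  have hσ : 0 < (τ / N).im := by
    rw [Complex.div_natCast_im]
    positivity
  rw [tsum_int_eq_zero_add_two_mul_tsum_pnat (fun n ↦ by simp [hodd])
    (summable_int_theta hN hF hσ), Int.cast_zero, zero_mul, zero_mul, zero_add, two_nsmul,
    ← two_mul, theta]
  congr 1
  rw [tsum_pnat_eq_tsum_succ (f := fun n : ℕ ↦ ((n : ℤ) : ℂ) * F n *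
    Complex.exp (π * I * ((n : ℤ) : ℂ) ^ 2 * (τ / N)))]
  refine tsum_congr fun n ↦ ?_
  push_cast
  rw [pow_one, mul_div_assoc]

lemma hasSum_jacobiTheta₂'' (z : ℂ) {τ : ℂ} (hτ : 0 < τ.im) :
    HasSum (fun n : ℤ ↦ (n + z) * Complex.exp (π * I * (n + z) ^ 2 * τ)) (jacobiTheta₂'' z τ) := by
  refine ((((hasSum_jacobiTheta₂'_term (z * τ) hτ).div_const (2 * π * I)).add
    ((hasSum_jacobiTheta₂_term (z * τ) hτ).mul_left z)).mul_left
    (Complex.exp (π * I * z ^ 2 * τ))).congr_fun fun n ↦ ?_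
  rw [jacobiTheta₂'_term, mul_assoc (2 * π * I), mul_div_cancel_left₀ _ two_pi_I_ne_zero, ← add_mul,
    mul_left_comm, jacobiTheta₂_term, ← Complex.exp_add]
  ring_nf

lemma tsum_int_mul_eq_sum_jacobiTheta₂'' {F : ℤ → ℂ} {N : ℕ} (hN : 0 < N)
    (hF : Function.Periodic F N) {σ : ℂ} (hσ : 0 < σ.im) :
    ∑' n : ℤ, (n : ℂ) * F n * Complex.exp (π * I * (n : ℂ) ^ 2 * (σ / N)) =
      ∑ m ∈ Finset.range N, N * F m * jacobiTheta₂'' (m / N) (N * σ) := by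
  have : NeZero N := ⟨hN.ne'⟩
  have hN' : (N : ℂ) ≠ 0 := by exact_mod_cast hN.ne'
  have hσ' : 0 < (σ / N).im := by
    rw [Complex.div_natCast_im]
    positivity
  have hσ'' : 0 < (N * σ).im := by
    rw [← Complex.ofReal_natCast, Complex.im_ofReal_mul]
    positivity
  have hs := summable_int_theta hN hF hσ'
  rw [← (Int.divModEquiv N).symm.summable_iff, ← (Equiv.prodComm _ _).summable_iff] at hs
  simp only [Function.comp_def] at hs
  rw [← (Int.divModEquiv N).symm.tsum_eq, ← (Equiv.prodComm _ _).tsum_eq, hs.tsum_prod,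
    tsum_fintype,
    Finset.sum_range (fun m : ℕ ↦ (N : ℂ) * F m * jacobiTheta₂'' (m / N) (N * σ))]
  refine Finset.sum_congr rfl fun m _ ↦ ?_
  rw [← (hasSum_jacobiTheta₂'' _ hσ'').tsum_eq, ← tsum_mul_left]
  refine tsum_congr fun k ↦ ?_
  simp only [Equiv.prodComm_apply, Prod.swap_prod_mk, Int.divModEquiv_symm_apply]
  have h0 : F (m + k * N) = F m := hF.int_mul k m
  rw [add_comm (k * (N : ℤ)), h0]
  have h1 : ((m + k * N : ℤ) : ℂ) = N * (k + m / N) := by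
    push_cast
    field_simp
    ring
  rw [h1]
  have h2 : π * I * (N * (k + m / N : ℂ)) ^ 2 * (σ / N) =
      π * I * (k + m / N : ℂ) ^ 2 * (N * σ) := by
    field_simp
  rw [h2]
  ring

lemma natCast_mul_cpow_three_halves {N : ℕ} (hN : 0 < N) {w : ℂ} (hw : w ≠ 0) :
    N * (-I * (w / N)) ^ (3 / 2 : ℂ) = ((√N : ℝ) : ℂ)⁻¹ * (w / I) ^ (3 / 2 : ℂ) := by
  have hN' : (N : ℂ) ≠ 0 := by exact_mod_cast hN.ne'
  have hNr : (0 : ℝ) < N := by exact_mod_cast hN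
  have hu : -I * (w / N) ≠ 0 := by simp [hw, hN']
  have h1 : w / I = ((N : ℝ) : ℂ) * (-I * (w / N)) := by
    push_cast
    rw [Complex.div_I]
    field_simp
  have h2 : (N : ℂ) ^ (3 / 2 : ℂ) = N * ((√N : ℝ) : ℂ) := by
    rw [show (3 / 2 : ℂ) = 1 + 1 / 2 by norm_num, cpow_add _ _ hN', cpow_one, Real.sqrt_eq_rpow,
      ofReal_cpow hNr.le]
    push_cast
    rfl
  have h3 : ((√N : ℝ) : ℂ) ≠ 0 := by exact_mod_cast (Real.sqrt_pos.mpr hNr).ne'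
  have h4 : (w / I) ^ (3 / 2 : ℂ) = (N : ℂ) ^ (3 / 2 : ℂ) * (-I * (w / N)) ^ (3 / 2 : ℂ) := by
    rw [h1, cpow_def_of_ne_zero (mul_ne_zero (by simpa using hN') hu), cpow_def_of_ne_zero hN',
      cpow_def_of_ne_zero hu, Complex.log_ofReal_mul hNr hu, ← Complex.exp_add,
      Complex.ofReal_log hNr.le]
    push_cast
    ring_nf
  rw [h4, h2]
  field_simp

/-- The inversion formula for the weight `3/2` theta series of a periodic function, in terms of
its finite Fourier transform. -/
theorem tsum_int_theta_neg_inv {F : ℤ → ℂ} {N : ℕ} (hN : 0 < N) (hF : Function.Periodic F N)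
    {w : ℂ} (hw : 0 < w.im) :
    ∑' n : ℤ, (n : ℂ) * F n * Complex.exp (π * I * (n : ℂ) ^ 2 * (-1 / w / N)) =
      -I * ((√N : ℝ) : ℂ)⁻¹ * (w / I) ^ (3 / 2 : ℂ) *
        ∑' n : ℤ, (n : ℂ) * (∑ m ∈ Finset.range N, F m * Complex.exp (2 * π * I * n * m / N)) *
          Complex.exp (π * I * (n : ℂ) ^ 2 * (w / N)) := by
  have hN' : (N : ℂ) ≠ 0 := by exact_mod_cast hN.ne'
  have hw0 : w ≠ 0 := by rintro rfl; simp at hw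
  have hσ : 0 < (-1 / w).im := by
    rw [neg_div, neg_im, one_div, inv_im, neg_div, neg_neg]
    exact div_pos hw (normSq_pos.mpr hw0)
  have hwN : 0 < (w / N).im := by
    rw [Complex.div_natCast_im]
    positivity
  have hu : (-I * (w / N)) ^ (3 / 2 : ℂ) ≠ 0 := by
    simp [cpow_eq_zero_iff, hw0, hN']
  rw [tsum_int_mul_eq_sum_jacobiTheta₂'' hN hF hσ]
  have hsum (m : ℕ) : HasSum (fun n : ℤ ↦ (n : ℂ) * (F m * Complex.exp (2 * π * I * n * m / N)) *
      Complex.exp (π * I * (n : ℂ) ^ 2 * (w / N)))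
      (F m * (jacobiTheta₂' (m / N) (w / N) / (2 * π * I))) := by
    refine (((hasSum_jacobiTheta₂'_term (m / N) hwN).div_const (2 * π * I)).mul_left
      (F m)).congr_fun fun n ↦ ?_
    rw [jacobiTheta₂'_term, mul_assoc (2 * π * I) (n : ℂ) (jacobiTheta₂_term _ _ _),
      mul_div_cancel_left₀ _ two_pi_I_ne_zero, jacobiTheta₂_term, Complex.exp_add,
      mul_div_assoc _ (m : ℂ)]
    ring
  simp only [Finset.mul_sum, Finset.sum_mul]
  rw [(hasSum_sum fun m _ ↦ hsum m).tsum_eq, Finset.mul_sum]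
  refine Finset.sum_congr rfl fun m _ ↦ ?_
  rw [jacobiTheta₂'_functional_equation', mul_right_comm (-I), mul_assoc (-I),
    mul_comm _ (((√N : ℝ) : ℂ)⁻¹), ← natCast_mul_cpow_three_halves hN hw0,
    show -1 / (w / (N : ℂ)) = N * (-1 / w) by field_simp]
  generalize (-I * (w / N)) ^ (3 / 2 : ℂ) = u at hu
  generalize jacobiTheta₂'' (m / N) (N * (-1 / w)) = J
  field_simp

lemma periodic_mul_exp_sq {f : ℤ → ℂ} {M : ℕ} (hM : 0 < M) (hMeven : Even M)
    (hf : Function.Periodic f M) (a : ℤ) {c : ℕ} (hc : 0 < c) :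
    Function.Periodic (fun m : ℤ ↦ f m * Complex.exp (π * I * a * (m : ℂ) ^ 2 / (c * M)))
      (c * M : ℕ) := by
  intro m
  have hc' : (c : ℂ) ≠ 0 := by exact_mod_cast hc.ne'
  have hM' : (M : ℂ) ≠ 0 := by exact_mod_cast hM.ne'
  obtain ⟨K, hK⟩ := hMeven
  have hMK : (M : ℂ) = 2 * K := by rw [hK]; push_cast; ring
  have h1 : f (m + (c * M : ℕ)) = f m := by
    push_cast
    exact hf.nat_mul c m
  have h2 : Complex.exp (π * I * a * ((m + (c * M : ℕ) : ℤ) : ℂ) ^ 2 / (c * M)) =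
      Complex.exp (π * I * a * (m : ℂ) ^ 2 / (c * M)) := by
    refine Complex.exp_eq_exp_iff_exists_int.mpr ⟨a * m + a * c * K, ?_⟩
    have h3 : ((m + (c * M : ℕ) : ℤ) : ℂ) ^ 2 / (c * M) =
        (m : ℂ) ^ 2 / (c * M) + 2 * m + c * M := by
      push_cast
      field_simp
      ring
    rw [mul_div_assoc, h3, hMK]
    push_cast
    ring
  simp only [h1, h2]

lemma periodic_mul_exp_mul {F : ℤ → ℂ} {N : ℕ} (hN : 0 < N) (hF : Function.Periodic F N) (n : ℤ) :
    Function.Periodic (fun m : ℤ ↦ F m * Complex.exp (2 * π * I * n * m / N)) N := by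
  intro m
  have hN' : (N : ℂ) ≠ 0 := by exact_mod_cast hN.ne'
  have h2 : Complex.exp (2 * π * I * n * ((m + N : ℤ) : ℂ) / N) =
      Complex.exp (2 * π * I * n * m / N) := by
    refine Complex.exp_eq_exp_iff_exists_int.mpr ⟨n, ?_⟩
    push_cast
    field_simp
  simp only [hF m, h2]

lemma sum_range_mul_exp_neg {F : ℤ → ℂ} {N : ℕ} (hN : 0 < N) (hF : Function.Periodic F N)
    (hodd : ∀ n, F (-n) = -F n) (n : ℤ) :
    ∑ m ∈ Finset.range N, F m * Complex.exp (2 * π * I * (-n : ℤ) * m / N) =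
      -∑ m ∈ Finset.range N, F m * Complex.exp (2 * π * I * n * m / N) := by
  have h1 := (periodic_mul_exp_mul hN hF n).sum_range_neg
  simp only [hodd, Int.cast_natCast] at h1
  rw [← h1, ← Finset.sum_neg_distrib]
  refine Finset.sum_congr rfl fun m _ ↦ ?_
  push_cast
  ring_nf

/-- Completing the square in a finite Fourier transform twisted by a quadratic phase. -/
lemma exp_mul_sum_range_mul_exp {f : ℤ → ℂ} {M : ℕ} (hM : 0 < M) (hMeven : Even M)
    (hf : Function.Periodic f M) {a b d : ℤ} {c : ℕ} (hc : 0 < c) (hdet : a * d - b * (c : ℤ) = 1)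
    (n : ℤ) :
    Complex.exp (π * I * d * (n : ℂ) ^ 2 / (c * M)) *
        ∑ m ∈ Finset.range (c * M), f m * Complex.exp (π * I * a * (m : ℂ) ^ 2 / (c * M)) *
          Complex.exp (2 * π * I * (-n : ℤ) * m / (c * M : ℕ)) =
      Complex.exp (π * I * b * d * (n : ℂ) ^ 2 / M) *
        ∑ r ∈ Finset.range M, f (r + d * n) *
          (∑ j ∈ Finset.range c,
            Complex.exp (π * I * a * (((r : ℤ) : ℂ) + j * M) ^ 2 / (c * M))) *
          Complex.exp (2 * π * I * b * n * r / M) := by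
  have hc' : (c : ℂ) ≠ 0 := by exact_mod_cast hc.ne'
  have hM' : (M : ℂ) ≠ 0 := by exact_mod_cast hM.ne'
  have hdet' : (b : ℂ) * c = a * d - 1 := by
    have : (a : ℂ) * d - b * c = 1 := by exact_mod_cast hdet
    linear_combination -this
  have hshift := (periodic_mul_exp_mul (Nat.mul_pos hc hM)
    (periodic_mul_exp_sq hM hMeven hf a hc) (-n)).sum_range_add (d * n)
  simp only [Int.cast_natCast] at hshift
  rw [← hshift, Finset.sum_range_mul_eq_sum_sum, Finset.mul_sum, Finset.mul_sum]
  refine Finset.sum_congr rfl fun r _ ↦ ?_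
  rw [Finset.mul_sum, Finset.mul_sum, Finset.sum_mul, Finset.mul_sum]
  refine Finset.sum_congr rfl fun j _ ↦ ?_
  have hfr : f ((r + j * M : ℕ) + d * n) = f (r + d * n) := by
    rw [← hf.nat_mul j (r + d * n)]
    push_cast
    ring_nf
  have hexp : Complex.exp (π * I * d * (n : ℂ) ^ 2 / (c * M)) *
      (Complex.exp (π * I * a * (((r + j * M : ℕ) + d * n : ℤ) : ℂ) ^ 2 / (c * M)) *
        Complex.exp (2 * π * I * (-n : ℤ) * ((r + j * M : ℕ) + d * n : ℤ) / (c * M : ℕ))) =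
      Complex.exp (π * I * b * d * (n : ℂ) ^ 2 / M) *
        (Complex.exp (π * I * a * (((r : ℤ) : ℂ) + j * M) ^ 2 / (c * M)) *
          Complex.exp (2 * π * I * b * n * r / M)) := by
    simp only [← Complex.exp_add]
    refine Complex.exp_eq_exp_iff_exists_int.mpr ⟨b * n * j, ?_⟩
    push_cast
    field_simp
    linear_combination (-(d * n ^ 2 : ℂ) - 2 * n * (r + j * M)) * hdet'
  rw [hfr]
  linear_combination f (r + d * n) * hexp

end PartialTheta

/-- For `M` even, `f` odd `M`-periodic, and `γ = (a b; c d) ∈ SL(2,ℤ)` with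
`c > 0`, the function `h(n) = (cM)^{-1/2} e^{iπbdn²/M} Σ_{r mod M} f(r+dn) g(r) e^{2πibnr/M}`,
with `g(r) = Σ_{ℓ mod cM, ℓ≡r mod M} e^{iπaℓ²/(cM)}`, is well defined, odd and `M`-periodic,
and `Θ(γ(τ);1,f,M) = i((cτ+d)/i)^{3/2} Θ(τ;1,h,M)` on `ℍ`. -/
theorem statement16 (M : ℕ) (hM : 0 < M) (hMeven : Even M)
    (f : ℤ → ℂ) (hf : ∀ n : ℤ, f (n + M) = f n) (hodd : ∀ n : ℤ, f (-n) = -f n)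
    (a b d : ℤ) (c : ℕ) (hc : 0 < c) (hdet : a * d - b * (c : ℤ) = 1)
    (g : ℤ → ℂ)
    (hg : ∀ r : ℤ, g r = ∑ j ∈ Finset.range c,
      Complex.exp (Real.pi * Complex.I * (a : ℂ) * ((r : ℂ) + (j : ℂ) * (M : ℂ)) ^ 2 /
        ((c : ℂ) * (M : ℂ))))
    (h : ℤ → ℂ)
    (hh : ∀ n : ℤ, h n = ((Real.sqrt (c * M) : ℝ) : ℂ)⁻¹ *
      Complex.exp (Real.pi * Complex.I * (b : ℂ) * (d : ℂ) * (n : ℂ) ^ 2 / (M : ℂ)) *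
      ∑ r ∈ Finset.range M, f ((r : ℤ) + d * n) * g r *
        Complex.exp (2 * Real.pi * Complex.I * (b : ℂ) * (n : ℂ) * (r : ℂ) / (M : ℂ))) :
    (∀ n : ℤ, h (n + M) = h n) ∧ (∀ n : ℤ, h (-n) = -h n) ∧
    ∀ τ : ℂ, 0 < τ.im →
      theta M 1 f (((a : ℂ) * τ + (b : ℂ)) / ((c : ℂ) * τ + (d : ℂ)))
        = Complex.I * (((c : ℂ) * τ + (d : ℂ)) / Complex.I) ^ ((3 : ℂ) / 2) *
          theta M 1 h τ := by
  have hcM := Nat.mul_pos hc hM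
  have hc' : (c : ℂ) ≠ 0 := by exact_mod_cast hc.ne'
  have hM' : (M : ℂ) ≠ 0 := by exact_mod_cast hM.ne'
  set F : ℤ → ℂ := fun m ↦ f m * Complex.exp (Real.pi * I * a * (m : ℂ) ^ 2 / (c * M)) with hFdef
  set Fh : ℤ → ℂ := fun n ↦ ∑ m ∈ Finset.range (c * M),
    F m * Complex.exp (2 * Real.pi * I * n * m / (c * M : ℕ)) with hFh
  have hF : Function.Periodic F (c * M : ℕ) := periodic_mul_exp_sq hM hMeven hf a hc
  have hFodd (n : ℤ) : F (-n) = -F n := by simp [hFdef, hodd]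
  have hFhodd (n : ℤ) : Fh (-n) = -Fh n := sum_range_mul_exp_neg hcM hF hFodd n
  have hhF (n : ℤ) : h n = -(((Real.sqrt (c * M : ℕ) : ℝ) : ℂ)⁻¹ *
      Complex.exp (Real.pi * I * d * (n : ℂ) ^ 2 / (c * M)) * Fh n) := by
    have hkey := exp_mul_sum_range_mul_exp hM hMeven hf hc hdet n
    rw [hh, mul_assoc (_⁻¹)]
    simp only [hg]
    rw [← hkey, ← mul_neg, ← hFhodd, mul_assoc (_⁻¹)]
    simp only [hFh, hFdef, Int.cast_natCast, Nat.cast_mul]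
  have hhper (n : ℤ) : h (n + M) = h n := by
    obtain ⟨K, hK⟩ := hMeven
    have hMK : (M : ℂ) = 2 * K := by rw [hK]; push_cast; ring
    have h1 : Complex.exp (Real.pi * I * b * d * ((n + M : ℤ) : ℂ) ^ 2 / M) =
        Complex.exp (Real.pi * I * b * d * (n : ℂ) ^ 2 / M) := by
      refine Complex.exp_eq_exp_iff_exists_int.mpr ⟨b * d * n + b * d * K, ?_⟩
      have h2 : ((n + M : ℤ) : ℂ) ^ 2 / M = (n : ℂ) ^ 2 / M + 2 * n + M := by
        push_cast
        field_simp
        ring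
      rw [mul_div_assoc, h2, hMK]
      push_cast
      ring
    rw [hh, hh, h1]
    congr 1
    refine Finset.sum_congr rfl fun r _ ↦ ?_
    have h3 : f (r + d * (n + M)) = f (r + d * n) := by
      rw [mul_add, ← add_assoc]
      exact Function.Periodic.int_mul hf d (r + d * n)
    have h4 : Complex.exp (2 * Real.pi * I * b * ((n + M : ℤ) : ℂ) * r / M) =
        Complex.exp (2 * Real.pi * I * b * n * r / M) := by
      refine Complex.exp_eq_exp_iff_exists_int.mpr ⟨b * r, ?_⟩
      push_cast
      field_simp
    rw [h3, h4]
  have hhodd (n : ℤ) : h (-n) = -h n := by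
    rw [hhF, hhF, hFhodd]
    push_cast
    ring_nf
  refine ⟨hhper, hhodd, fun τ hτ ↦ ?_⟩
  set w : ℂ := c * τ + d with hw
  have hwim : 0 < w.im := by
    rw [hw, add_im, Complex.intCast_im, add_zero, ← Complex.ofReal_natCast, Complex.im_ofReal_mul]
    positivity
  have hw0 : w ≠ 0 := by
    intro h0
    simp [h0] at hwim
  have hdet' : (a : ℂ) * d - b * c = 1 := by exact_mod_cast hdet
  have hγ : (a * τ + b) / w = a / c + -1 / (c * w) := by
    field_simp
    rw [hw]
    linear_combination -hdet'
  have hγim : 0 < ((a * τ + b) / w).im := by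
    have h1 : (a / c : ℂ).im = 0 := by
      rw [Complex.div_natCast_im, Complex.intCast_im, zero_div]
    have h2 : -1 / (c * w) = ((-w⁻¹) / c : ℂ) := by field_simp
    rw [hγ, add_im, h1, zero_add, h2, Complex.div_natCast_im, neg_im, inv_im, neg_div (normSq w),
      neg_neg]
    have := normSq_pos.mpr hw0
    positivity
  have hL := two_mul_theta_one hM hf hodd hγim
  have hR := two_mul_theta_one hM hhper hhodd hτ
  have hS := tsum_int_theta_neg_inv hcM hF hwim
  have hL' : 2 * theta M 1 f ((a * τ + b) / w) = ∑' n : ℤ, (n : ℂ) * F n *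
      Complex.exp (Real.pi * I * (n : ℂ) ^ 2 * (-1 / w / (c * M : ℕ))) := by
    rw [hL]
    refine tsum_congr fun n ↦ ?_
    rw [hFdef, hγ, ← mul_assoc, mul_assoc _ (Complex.exp _) (Complex.exp _), ← Complex.exp_add]
    congr 2
    push_cast
    field_simp
  have hR' : 2 * theta M 1 h τ = -((Real.sqrt (c * M : ℕ) : ℝ) : ℂ)⁻¹ * ∑' n : ℤ, (n : ℂ) * Fh n *
      Complex.exp (Real.pi * I * (n : ℂ) ^ 2 * (w / (c * M : ℕ))) := by
    rw [hR, ← tsum_mul_left]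
    refine tsum_congr fun n ↦ ?_
    have h1 : Complex.exp (Real.pi * I * (n : ℂ) ^ 2 * (w / (c * M : ℕ))) =
        Complex.exp (Real.pi * I * d * (n : ℂ) ^ 2 / (c * M)) *
          Complex.exp (Real.pi * I * (n : ℂ) ^ 2 * (τ / M)) := by
      rw [← Complex.exp_add, hw]
      congr 1
      push_cast
      field_simp
      ring
    rw [hhF, h1]
    ring
  refine mul_left_cancel₀ (two_ne_zero (α := ℂ)) ?_
  rw [hL', hS, mul_left_comm, hR']
  ring
end

section
/- Let M be an even positive integer and γ = (a b; c d) ∈ SL(2, ℤ) with c > 0 and c ≡ 0 mod 2M (so γ ∈ Γ₀(2M), and d is odd). For r ∈ ℤ define g(r) := Σ_{ℓ mod cM, ℓ ≡ r mod M} e^{iπ a ℓ²/(cM)}. Then g(r) = 0 whenever r ≢ 0 mod M, and g(0) = (cM)^{1/2} e^{iπ/4} ε_d^{-1} (2Mc / |d|), where (2Mc/|d|) is the Jacobi symbol and ε_d := 1 if d ≡ 1 mod 4, ε_d := i if d ≡ 3 mod 4. -/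
open Complex

section GaussSum

open Filter Topology
open scoped Real ComplexConjugate

/-- The quadratic Gauss sum `∑_{j < q} e^{π i p j² / q}`. -/
noncomputable def quadGaussSum (p : ℤ) (q : ℕ) : ℂ :=
  ∑ j ∈ Finset.range q, cexp (π * I * p * (j : ℂ) ^ 2 / q)

lemma cexp_pi_mul_I_mul_even {n : ℤ} (hn : Even n) : cexp (π * I * n) = 1 := by
  obtain ⟨m, rfl⟩ := hn
  rw [Complex.exp_eq_one_iff]
  exact ⟨m, by push_cast; ring⟩

lemma jacobiTheta₂_term_rat_add (p : ℤ) {q : ℕ} (hq : 0 < q) (hpq : Even (p * q)) (w : ℂ)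
    (m : ℤ) (r : ℕ) :
    jacobiTheta₂_term (m * q + r) 0 (p / q + I * w) =
      cexp (π * I * p * (r : ℂ) ^ 2 / q) * cexp (-π * w * r ^ 2) *
        jacobiTheta₂_term m (I * w * r * q) (I * w * q ^ 2) := by
  have hq' : (q : ℂ) ≠ 0 := by exact_mod_cast hq.ne'
  have h : cexp (π * I * (2 * (r * m * p) + p * q * m ^ 2 : ℤ)) = 1 :=
    cexp_pi_mul_I_mul_even ((even_two_mul _).add (hpq.mul_right _))
  rw [jacobiTheta₂_term, jacobiTheta₂_term, ← Complex.exp_add, ← Complex.exp_add]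
  rw [← mul_one (cexp (_ + _ + _)), ← h, ← Complex.exp_add]
  congr 1
  push_cast
  field_simp
  linear_combination q * w * r ^ 2 * I_sq

/-- Transformation of the theta function near a rational point, by Poisson summation in
each residue class. -/
lemma jacobiTheta₂_rat_add (p : ℤ) {q : ℕ} (hq : 0 < q) (hpq : Even (p * q)) {w : ℂ}
    (hw : 0 < w.re) :
    jacobiTheta₂ 0 (p / q + I * w) = 1 / (w * (q : ℂ) ^ 2) ^ (1 / 2 : ℂ) *
      ∑ r ∈ Finset.range q, cexp (π * I * p * (r : ℂ) ^ 2 / q) *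
        jacobiTheta₂ (r / q : ℝ) (I / (w * q ^ 2)) := by
  have hq' : (q : ℂ) ≠ 0 := by exact_mod_cast hq.ne'
  have hw' : w ≠ 0 := by rintro rfl; simp at hw
  have him : 0 < ((p : ℂ) / q + I * w).im := by
    have : ((p : ℂ) / q).im = 0 := by
      rw [show ((p : ℂ) / q) = ((p / q : ℝ) : ℂ) by push_cast; rfl, ofReal_im]
    simpa [this] using hw
  have him' : 0 < (I * w * (q : ℂ) ^ 2).im := by
    rw [show I * w * (q : ℂ) ^ 2 = ((q ^ 2 : ℝ) : ℂ) * (I * w) by push_cast; ring, im_ofReal_mul]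
    simp only [mul_im, I_re, I_im]
    have : (0 : ℝ) < (q : ℝ) ^ 2 := by positivity
    simpa using mul_pos this hw
  have : NeZero q := ⟨hq.ne'⟩
  have h1 := hasSum_jacobiTheta₂_term 0 him
  rw [← (Int.divModEquiv q).symm.hasSum_iff, ← (Equiv.prodComm _ _).hasSum_iff] at h1
  have h2 := h1.prod_fiberwise (g := fun r : Fin q ↦
      cexp (π * I * p * ((r : ℕ) : ℂ) ^ 2 / q) * cexp (-π * w * (r : ℕ) ^ 2) *
        jacobiTheta₂ (I * w * (r : ℕ) * q) (I * w * q ^ 2)) (fun r ↦ by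
    refine ((hasSum_jacobiTheta₂_term _ him').mul_left _).congr_fun fun m ↦ ?_
    simpa [Int.divModEquiv] using jacobiTheta₂_term_rat_add p hq hpq w m r)
  rw [← (hasSum_fintype _).unique h2, Finset.mul_sum, Finset.sum_range]
  refine Finset.sum_congr rfl fun r _ ↦ ?_
  rw [jacobiTheta₂_functional_equation]
  have e1 : -I * (I * w * (q : ℂ) ^ 2) = w * (q : ℂ) ^ 2 := by linear_combination -w * q ^ 2 * I_sq
  have e2 : I * w * (r : ℕ) * q / (I * w * q ^ 2) = (((r : ℕ) / q : ℝ) : ℂ) := by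
    push_cast; field_simp
  have e3 : -1 / (I * w * (q : ℂ) ^ 2) = I / (w * q ^ 2) := by
    field_simp; rw [I_sq]
  have e4 : cexp (-π * I * (I * w * (r : ℕ) * q) ^ 2 / (I * w * q ^ 2)) =
      (cexp (-π * w * (r : ℕ) ^ 2))⁻¹ := by
    rw [← Complex.exp_neg]
    congr 1
    field_simp
    linear_combination (-(r : ℕ) ^ 2 : ℂ) * I_sq
  rw [e1, e2, e3, e4]
  field_simp

lemma tendsto_jacobiTheta₂_one_s17 {α : Type*} {l : Filter α} [l.IsCountablyGenerated]
    (x : ℝ) {f : α → ℂ} (hf : Tendsto (fun a ↦ (f a).im) l atTop) :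
    Tendsto (fun a ↦ jacobiTheta₂ x (f a)) l (𝓝 1) := by
  have hone : (∑' n : ℤ, if n = 0 then (1 : ℂ) else 0) = 1 := by simp
  rw [← hone]
  refine tendsto_tsum_of_dominated_convergence
    (bound := fun n : ℤ ↦ rexp (-π * (1 * n ^ 2 - 2 * 0 * |n|))) ?_ ?_ ?_
  · simpa using summable_pow_mul_jacobiTheta₂_term_bound 0 one_pos 0
  · intro n
    split_ifs with hn
    · simpa [hn, jacobiTheta₂_term] using tendsto_const_nhds
    · rw [tendsto_zero_iff_norm_tendsto_zero]
      simp only [norm_jacobiTheta₂_term, ofReal_im, mul_zero, sub_zero]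
      refine Real.tendsto_exp_atBot.comp ?_
      refine hf.const_mul_atTop_of_neg ?_
      have : (0 : ℝ) < (n : ℝ) ^ 2 := by positivity
      nlinarith [Real.pi_pos]
  · filter_upwards [hf.eventually_ge_atTop 1] with a ha n
    exact norm_jacobiTheta₂_term_le one_pos (by simp) ha n

lemma tendsto_sqrt_mul_jacobiTheta₂ (p : ℤ) {q : ℕ} (hq : 0 < q) (hpq : Even (p * q))
    {u : ℝ → ℂ} {u₀ : ℂ} (hu : Tendsto u (𝓝[>] 0) (𝓝 u₀)) (hu₀ : 0 < u₀.re) :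
    Tendsto (fun t : ℝ ↦ (√t : ℂ) * jacobiTheta₂ 0 (p / q + I * (t * u t))) (𝓝[>] 0)
      (𝓝 (1 / (q * u₀ ^ (1 / 2 : ℂ)) * quadGaussSum p q)) := by
  have hq' : (q : ℂ) ≠ 0 := by exact_mod_cast hq.ne'
  have hq'' : (0 : ℝ) < q := by exact_mod_cast hq
  have hu₀' : u₀ ≠ 0 := by rintro rfl; simp at hu₀
  have hinv : 0 < (u₀⁻¹).re := by
    rw [inv_re]; exact div_pos hu₀ (normSq_pos.2 hu₀')
  have him : Tendsto (fun t : ℝ ↦ (I / ((t * u t) * (q : ℂ) ^ 2)).im) (𝓝[>] 0) atTop := by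
    have h1 : Tendsto (fun t ↦ ((u t)⁻¹).re) (𝓝[>] 0) (𝓝 (u₀⁻¹).re) :=
      (continuous_re.tendsto _).comp (hu.inv₀ hu₀')
    have h2 := (tendsto_inv_nhdsGT_zero (𝕜 := ℝ)).atTop_mul_pos (C := (u₀⁻¹).re / q ^ 2)
      (by positivity) (h1.div_const ((q : ℝ) ^ 2))
    refine h2.congr fun t ↦ ?_
    rw [show I / ((t * u t) * (q : ℂ) ^ 2) = ((t⁻¹ / q ^ 2 : ℝ) : ℂ) * ((u t)⁻¹ * I) by
      push_cast; simp only [div_eq_mul_inv, mul_inv]; ring, im_ofReal_mul, mul_I_im]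
    ring
  have hsum : Tendsto (fun t : ℝ ↦ 1 / (q * u t ^ (1 / 2 : ℂ)) *
      ∑ r ∈ Finset.range q, cexp (π * I * p * (r : ℂ) ^ 2 / q) *
        jacobiTheta₂ (r / q : ℝ) (I / ((t * u t) * q ^ 2))) (𝓝[>] 0)
      (𝓝 (1 / (q * u₀ ^ (1 / 2 : ℂ)) *
        ∑ r ∈ Finset.range q, cexp (π * I * p * (r : ℂ) ^ 2 / q) * 1)) := by
    refine Tendsto.mul ?_ (tendsto_finsetSum _ fun r _ ↦
      tendsto_const_nhds.mul (tendsto_jacobiTheta₂_one_s17 _ him))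
    refine tendsto_const_nhds.div (tendsto_const_nhds.mul
      (hu.cpow tendsto_const_nhds (Or.inl hu₀))) ?_
    exact mul_ne_zero hq' (by simp [cpow_eq_zero_iff, hu₀'])
  simp only [mul_one] at hsum
  refine hsum.congr' ?_
  filter_upwards [self_mem_nhdsWithin,
    ((continuous_re.tendsto _).comp hu).eventually_const_lt hu₀] with t (ht : 0 < t) hut
  have hw : 0 < ((t : ℂ) * u t).re := by rw [re_ofReal_mul]; exact mul_pos ht hut
  have hst : (√t : ℂ) ≠ 0 := by exact_mod_cast (Real.sqrt_pos.2 ht).ne'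
  have hcpow : ((t * u t) * (q : ℂ) ^ 2) ^ (1 / 2 : ℂ) = √t * q * u t ^ (1 / 2 : ℂ) := by
    have hu0 : u t ≠ 0 := by intro h; simp [h] at hut
    have htq : 0 < t * q ^ 2 := by positivity
    rw [show (t * u t) * (q : ℂ) ^ 2 = ((t * q ^ 2 : ℝ) : ℂ) * u t by push_cast; ring,
      cpow_def_of_ne_zero (mul_ne_zero (by exact_mod_cast htq.ne') hu0),
      log_ofReal_mul htq hu0, add_mul, Complex.exp_add, ofReal_log htq.le,
      ← cpow_def_of_ne_zero (by exact_mod_cast htq.ne'), ← cpow_def_of_ne_zero hu0,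
      show (1 / 2 : ℂ) = ((1 / 2 : ℝ) : ℂ) by push_cast; rfl, ← ofReal_cpow htq.le,
      ← Real.sqrt_eq_rpow, Real.sqrt_mul ht.le, Real.sqrt_sq hq''.le]
    push_cast
    ring
  rw [jacobiTheta₂_rat_add p hq hpq hw, hcpow]
  field_simp

lemma neg_I_mul_cpow_half {x : ℝ} (hx : 0 < x) :
    (-I * x) ^ (1 / 2 : ℂ) = √x * cexp (-(π * I / 4)) := by
  rw [mul_comm, cpow_def_of_ne_zero (by simp [hx.ne']), log_ofReal_mul hx (by simp), log_neg_I,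
    add_mul, Complex.exp_add, ofReal_log hx.le, ← cpow_def_of_ne_zero (by exact_mod_cast hx.ne'),
    show (1 / 2 : ℂ) = ((1 / 2 : ℝ) : ℂ) by push_cast; rfl, ← ofReal_cpow hx.le,
      ← Real.sqrt_eq_rpow]
  congr 2
  push_cast
  ring

/-- Reciprocity for quadratic Gauss sums (Landsberg–Schaar). -/
theorem quadGaussSum_reciprocity {a c : ℕ} (ha : 0 < a) (hc : 0 < c) (hac : Even (a * c)) :
    quadGaussSum a c = √(c / a) * cexp (π * I / 4) * quadGaussSum (-c) a := by
  have ha' : (a : ℂ) ≠ 0 := by exact_mod_cast ha.ne'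
  have hc' : (c : ℂ) ≠ 0 := by exact_mod_cast hc.ne'
  have ha'' : (0 : ℝ) < a := by exact_mod_cast ha
  have hc'' : (0 : ℝ) < c := by exact_mod_cast hc
  set τ : ℝ → ℂ := fun t ↦ (a : ℤ) / c + I * (t * 1) with hτ
  have hτ0 : Tendsto τ (𝓝[>] 0) (𝓝 (a / c)) := by
    have : Continuous τ := by fun_prop
    have := this.tendsto 0
    simp only [hτ, ofReal_zero, zero_mul, mul_zero, add_zero, Int.cast_natCast] at this
    exact this.mono_left nhdsWithin_le_nhds
  have hac0 : (a : ℂ) / c ≠ 0 := div_ne_zero ha' hc'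
  have hlim1 := tendsto_sqrt_mul_jacobiTheta₂ a hc (by exact_mod_cast hac)
    (u := fun _ ↦ 1) tendsto_const_nhds (by simp)
  have hu : Tendsto (fun t ↦ (c / a : ℂ) / τ t) (𝓝[>] 0) (𝓝 ((c / a) / (a / c))) :=
    tendsto_const_nhds.div hτ0 hac0
  have hu0 : (c / a : ℂ) / (a / c) = (((c / a) ^ 2 : ℝ) : ℂ) := by push_cast; field_simp
  rw [hu0] at hu
  have hlim2 := tendsto_sqrt_mul_jacobiTheta₂ (-c) ha
    (by rw [neg_mul, even_neg, mul_comm]; exact_mod_cast hac) hu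
    (by rw [ofReal_re]; positivity)
  have hlim3 : Tendsto (fun t ↦ 1 / (-I * τ t) ^ (1 / 2 : ℂ)) (𝓝[>] 0)
      (𝓝 (1 / (-I * (a / c : ℝ)) ^ (1 / 2 : ℂ))) := by
    refine tendsto_const_nhds.div
      ((Tendsto.mul tendsto_const_nhds ?_).cpow tendsto_const_nhds (Or.inr ?_)) ?_
    · simpa using hτ0
    · rw [mul_comm, im_ofReal_mul]
      simpa using ⟨ha.ne', hc.ne'⟩
    · simp [cpow_eq_zero_iff, ha.ne', hc.ne']
  have hlim := hlim3.mul hlim2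
  have key := tendsto_nhds_unique (hlim1.congr' (f₂ := _) ?_) hlim
  · rw [neg_I_mul_cpow_half (by positivity), Complex.exp_neg] at key
    have : (((c / a) ^ 2 : ℝ) : ℂ) ^ (1 / 2 : ℂ) = c / a := by
      rw [show (1 / 2 : ℂ) = ((1 / 2 : ℝ) : ℂ) by push_cast; rfl, ← ofReal_cpow (by positivity),
        ← Real.sqrt_eq_rpow, Real.sqrt_sq (by positivity)]
      push_cast; rfl
    rw [this, one_cpow] at key
    have hinv : (√(a / c : ℝ) : ℂ)⁻¹ = √(c / a : ℝ) := by
      rw [← ofReal_inv, ← Real.sqrt_inv, inv_div]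
    rw [← hinv]
    have := Complex.exp_ne_zero (π * I / 4)
    have hs : (√(a / c : ℝ) : ℂ) ≠ 0 := by
      exact_mod_cast (Real.sqrt_pos.2 (by positivity : (0 : ℝ) < a / c)).ne'
    field_simp at key ⊢
    linear_combination key
  · filter_upwards [self_mem_nhdsWithin] with t (ht : 0 < t)
    have hτt : τ t ≠ 0 := by
      intro h
      have := congrArg Complex.im h
      have h2 : ((a : ℂ) / c).im = 0 := by
        rw [show ((a : ℂ) / c) = ((a / c : ℝ) : ℂ) by push_cast; rfl, ofReal_im]
      simp [hτ, h2] at this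
      exact ht.ne' this
    rw [show ((a : ℤ) / c + I * (t * 1) : ℂ) = τ t from rfl, jacobiTheta₂_functional_equation]
    have : (-1 / τ t : ℂ) = ((-c : ℤ) : ℂ) / a + I * (t * ((c / a : ℂ) / τ t)) := by
      have : τ t = a / c + I * t := by simp [hτ]
      field_simp
      rw [this]
      push_cast
      field_simp
      ring
    rw [← this]
    simp
    ring

open scoped NumberTheorySymbols

lemma quadGaussSum_congr {p p' : ℤ} {q : ℕ} (h : p ≡ p' [ZMOD (2 * q)]) :
    quadGaussSum p q = quadGaussSum p' q := by
  obtain ⟨m, hm⟩ := h.symm.dvd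
  obtain rfl : p = p' + 2 * q * m := by linarith
  refine Finset.sum_congr rfl fun j hj ↦ ?_
  have hq : (q : ℂ) ≠ 0 := by
    have : q ≠ 0 := by rintro rfl; simp at hj
    exact_mod_cast this
  rw [← mul_one (cexp (π * I * p' * _ / _)), ← cexp_pi_mul_I_mul_even (even_two_mul (m * j ^ 2)),
    ← Complex.exp_add]
  congr 1
  push_cast
  field_simp

lemma Finset.sum_range_add_of_periodic {M : Type*} [AddCommMonoid M] {f : ℕ → M} {k : ℕ}
    (hf : ∀ x, f (x + k) = f x) (m : ℕ) :
    ∑ u ∈ Finset.range k, f (u + m) = ∑ u ∈ Finset.range k, f u := by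
  induction m with
  | zero => simp
  | succ m ih =>
    rw [← ih]
    rcases k with - | k
    · simp
    · rw [Finset.sum_range_succ, Finset.sum_range_succ']
      congr 1
      · exact Finset.sum_congr rfl fun u _ ↦ by congr 1; ring
      · rw [← hf (0 + m)]; congr 1; ring

lemma Finset.sum_range_two_mul {M : Type*} [AddCommMonoid M] (f : ℕ → M) (k : ℕ) :
    ∑ j ∈ Finset.range (2 * k), f j =
      ∑ u ∈ Finset.range k, f (2 * u) + ∑ u ∈ Finset.range k, f (2 * u + 1) := by
  induction k with
  | zero => simp
  | succ k ih =>
    rw [show 2 * (k + 1) = 2 * k + 1 + 1 by ring, Finset.sum_range_succ, Finset.sum_range_succ, ih,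
      Finset.sum_range_succ, Finset.sum_range_succ]
    abel

lemma quadGaussSum_two_mul_of_odd (a : ℤ) {k : ℕ} (hk : Odd k) :
    quadGaussSum a (2 * k) = quadGaussSum (2 * a) k * (1 + cexp (π * I / 2 * (a * k))) := by
  have hk' : (k : ℂ) ≠ 0 := by
    have : k ≠ 0 := hk.pos.ne'
    exact_mod_cast this
  rw [quadGaussSum, Finset.sum_range_two_mul, mul_add, mul_one]
  congr 1
  · refine Finset.sum_congr rfl fun j _ ↦ ?_
    congr 1
    push_cast
    field_simp
  · have hper : ∀ x : ℕ, cexp (π * I * a * ((2 * (x + k) + 1 : ℕ) : ℂ) ^ 2 / (2 * k : ℕ)) =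
        cexp (π * I * a * ((2 * x + 1 : ℕ) : ℂ) ^ 2 / (2 * k : ℕ)) := fun x ↦ by
      rw [← mul_one (cexp (π * I * a * ((2 * x + 1 : ℕ) : ℂ) ^ 2 / _)),
        ← cexp_pi_mul_I_mul_even (even_two_mul (a * (2 * x + 1 + k))), ← Complex.exp_add]
      congr 1
      push_cast
      field_simp
      ring
    obtain ⟨m, hm⟩ := id hk
    rw [← Finset.sum_range_add_of_periodic hper m, quadGaussSum, Finset.sum_mul]
    refine Finset.sum_congr rfl fun j _ ↦ ?_
    rw [← Complex.exp_add, ← mul_one (cexp (_ + _)),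
      ← cexp_pi_mul_I_mul_even (even_two_mul (a * j)), ← Complex.exp_add]
    congr 1
    have hm' : (k : ℂ) = 2 * m + 1 := by exact_mod_cast hm
    have : ((2 * (j + m) + 1 : ℕ) : ℂ) = 2 * j + k := by rw [hm']; push_cast; ring
    rw [this]
    push_cast
    field_simp
    ring

/-- `1` if `n ≡ 1 mod 4`, and `i` otherwise. -/
noncomputable def gaussEps (n : ℤ) : ℂ := if n % 4 = 1 then 1 else I

lemma quadGaussSum_neg (p : ℤ) (q : ℕ) : quadGaussSum (-p) q = conj (quadGaussSum p q) := by
  rw [quadGaussSum, quadGaussSum, map_sum]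
  refine Finset.sum_congr rfl fun j _ ↦ ?_
  rw [← Complex.exp_conj]
  congr 1
  simp

lemma conj_gaussEps {n : ℕ} (hn : Odd n) :
    conj (gaussEps n) = gaussEps n * ((ZMod.χ₄ n : ℤ) : ℂ) := by
  rcases Nat.odd_mod_four_iff.1 (Nat.odd_iff.1 hn) with h | h
  · have h' : (n : ℤ) % 4 = 1 := by omega
    simp [gaussEps, h', ZMod.χ₄_nat_one_mod_four h]
  · have h' : (n : ℤ) % 4 = 3 := by omega
    simp [gaussEps, h', ZMod.χ₄_nat_three_mod_four h]

lemma cexp_pi_mul_I_div_four : cexp (π * I / 4) = (1 + I) / (√2 : ℝ) := by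
  have h2 : ((√2 : ℝ) : ℂ) ^ 2 = 2 := by exact_mod_cast Real.sq_sqrt (zero_le_two)
  have h0 : ((√2 : ℝ) : ℂ) ≠ 0 := by exact_mod_cast (Real.sqrt_pos.2 zero_lt_two).ne'
  rw [show (π * I / 4 : ℂ) = ((π / 4 : ℝ) : ℂ) * I by push_cast; ring, Complex.exp_mul_I,
    ← ofReal_cos, ← ofReal_sin, Real.cos_pi_div_four, Real.sin_pi_div_four]
  push_cast
  field_simp
  rw [h2]

lemma one_add_I_mul_one_add_cexp {n : ℤ} (hn : Odd n) :
    (1 + I) * (1 + cexp (π * I / 2 * -n)) = 2 * gaussEps n := by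
  have hdiv := Int.emod_add_mul_ediv n 4
  have h1 : cexp (π * I / 2 * -n) = cexp (π * I / 2 * -(n % 4 : ℤ)) := by
    rw [← mul_one (cexp (_ * -((n % 4 : ℤ) : ℂ))),
      ← cexp_pi_mul_I_mul_even (even_two_mul (-(n / 4))), ← Complex.exp_add]
    congr 1
    nth_rw 1 [← hdiv]
    push_cast
    ring
  have h4 : n % 4 = 1 ∨ n % 4 = 3 := by have := Int.odd_iff.1 hn; omega
  have hI : cexp (π * I / 2) = I := by rw [mul_div_right_comm, exp_pi_div_two_mul_I]
  rw [h1]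
  rcases h4 with h | h
  · simp only [h, gaussEps, if_true, Int.cast_one, mul_neg, mul_one, Complex.exp_neg, hI, inv_I]
    linear_combination -I_sq
  · have : cexp (π * I / 2 * -(3 : ℤ)) = I := by
      rw [show (π * I / 2 * -(3 : ℤ) : ℂ) = π * I / 2 - 2 * π * I by push_cast; ring,
        Complex.exp_periodic.sub_eq, hI]
    rw [h, this, gaussEps, if_neg (by omega)]
    linear_combination I_sq

/-- The sign in quadratic reciprocity in terms of `gaussEps`. -/
lemma gaussEps_reciprocity {k n : ℕ} (hk : Odd k) (hn : Odd n) :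
    gaussEps (k * n) * conj (gaussEps k) * ((J(n | k) : ℤ) : ℂ) =
      gaussEps n * ((J(k | n) : ℤ) : ℂ) := by
  rcases Nat.odd_mod_four_iff.1 (Nat.odd_iff.1 hk) with h | h <;>
  rcases Nat.odd_mod_four_iff.1 (Nat.odd_iff.1 hn) with h' | h' <;>
  [rw [jacobiSym.quadratic_reciprocity_one_mod_four h hn];
   rw [jacobiSym.quadratic_reciprocity_one_mod_four h hn];
   rw [jacobiSym.quadratic_reciprocity_one_mod_four' hk h'];
   rw [jacobiSym.quadratic_reciprocity_three_mod_four h h']] <;>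
  · have h1 : ((k : ℤ) * n) % 4 = ((k % 4 : ℕ) : ℤ) * ((n % 4 : ℕ) : ℤ) % 4 := by
      push_cast; rw [← Int.mul_emod]
    have h2 : (k : ℤ) % 4 = ((k % 4 : ℕ) : ℤ) := by push_cast; rfl
    have h3 : (n : ℤ) % 4 = ((n % 4 : ℕ) : ℤ) := by push_cast; rfl
    simp only [gaussEps, h1, h2, h3, h, h']
    norm_num

theorem quadGaussSum_two_mul_eq {n : ℕ} (hn : Odd n) {k : ℤ} (hk : IsCoprime k n) :
    quadGaussSum (2 * k) n = gaussEps n * √n * ((J(k | n) : ℤ) : ℂ) := by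
  induction n using Nat.strong_induction_on generalizing k with
  | _ n ih =>
  have hneg : ∀ k : ℤ, quadGaussSum (2 * k) n = gaussEps n * √n * ((J(k | n) : ℤ) : ℂ) →
      quadGaussSum (2 * -k) n = gaussEps n * √n * ((J(-k | n) : ℤ) : ℂ) := fun k h ↦ by
    rw [mul_neg, quadGaussSum_neg, h, jacobiSym.neg _ hn, map_mul, map_mul, conj_gaussEps hn]
    simp
    ring
  have hmain : ∀ k : ℕ, Odd k → k < n → IsCoprime (k : ℤ) n →
      quadGaussSum (2 * k) n = gaussEps n * √n * ((J(k | n) : ℤ) : ℂ) := fun k hk hkn hcop ↦ by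
    have hr := quadGaussSum_reciprocity (a := 2 * k) (c := n) (by have := hk.pos; omega) hn.pos
      ((even_two_mul k).mul_right n)
    have h2 : quadGaussSum (2 * -(n : ℤ)) k = conj (gaussEps k) * √k * ((J(n | k) : ℤ) : ℂ) := by
      rw [mul_neg, quadGaussSum_neg, ih k hkn hk hcop.symm]
      simp
    have h3 := one_add_I_mul_one_add_cexp (n := k * n) (by exact_mod_cast hk.mul hn)
    rw [quadGaussSum_two_mul_of_odd _ hk, h2, cexp_pi_mul_I_div_four] at hr
    rw [mul_right_comm, ← gaussEps_reciprocity hk hn]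
    push_cast at hr h3
    rw [hr, show (-(n : ℂ) * k) = -(k * n) by ring]
    have hk0 : (0 : ℝ) < k := by exact_mod_cast hk.pos
    have hs : √((n : ℝ) / (2 * k)) * √k = √n / √2 := by
      rw [← Real.sqrt_mul (by positivity), ← Real.sqrt_div (by positivity)]
      congr 1
      field_simp
    have hs' : (√((n : ℝ) / (2 * k)) : ℂ) * (√k : ℂ) = √n / √2 := by exact_mod_cast hs
    have hs2 : ((√2 : ℝ) : ℂ) ^ 2 = 2 := by exact_mod_cast Real.sq_sqrt (zero_le_two)
    have h0 : ((√2 : ℝ) : ℂ) ≠ 0 := by exact_mod_cast (Real.sqrt_pos.2 zero_lt_two).ne'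
    calc _ = (√((n : ℝ) / (2 * k)) : ℂ) * (√k : ℂ) / (√2 : ℝ) * conj (gaussEps k) *
          ((J(n | k) : ℤ) : ℂ) * ((1 + I) * (1 + cexp (π * I / 2 * -(k * n)))) := by ring
      _ = _ := by
        rw [h3, hs', div_div, ← sq, hs2]
        ring
  rcases eq_or_ne n 1 with rfl | hn1
  · simp [quadGaussSum, gaussEps]
  have hn0 : (0 : ℤ) < n := by exact_mod_cast hn.pos
  have hr0 := Int.emod_nonneg k hn0.ne'
  have hrn := Int.emod_lt_of_pos k hn0
  have hcop : IsCoprime (k % n) (n : ℤ) := by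
    have := Int.emod_add_mul_ediv k n
    rw [← this] at hk
    exact (IsCoprime.add_mul_left_left_iff).1 hk
  have hrne : k % n ≠ 0 := by
    intro h
    rw [h, isCoprime_zero_left, Int.isUnit_iff] at hcop
    omega
  rw [jacobiSym.mod_left, quadGaussSum_congr (p' := 2 * (k % n))
    ((Int.mod_modEq k n).symm.mul_left' (c := 2))]
  rcases Int.even_or_odd (k % n) with he | ho
  · obtain ⟨r, hr⟩ : ∃ r : ℕ, (r : ℤ) = n - k % n := ⟨(n - k % n).toNat, by omega⟩
    have ho' : Odd r := by
      have : Odd (r : ℤ) := by rw [hr]; exact Odd.sub_even (by exact_mod_cast hn) he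
      exact_mod_cast this
    have hcop' : IsCoprime (r : ℤ) n := by
      rw [hr, sub_eq_neg_add]
      simpa using (IsCoprime.add_mul_left_left_iff (z := 1)).2 hcop.neg_left
    have := hneg _ (hmain r ho' (by omega) hcop')
    have hmod : -(r : ℤ) ≡ k % n [ZMOD n] := (Int.modEq_iff_dvd.2 ⟨1, by rw [hr]; ring⟩)
    rw [← jacobiSym.mod_left' hmod, ← quadGaussSum_congr (hmod.mul_left' (c := 2)), this]
  · obtain ⟨r, hr⟩ : ∃ r : ℕ, (r : ℤ) = k % n := ⟨(k % n).toNat, by omega⟩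
    rw [← hr] at ho hcop ⊢
    exact hmain r (by exact_mod_cast ho) (by omega) hcop

lemma jacobiSym_eq_one_of_modEq {k N : ℕ} (hk : 0 < k)
    (h : (N : ℤ) ≡ 1 [ZMOD (4 * k)] ∨ (N : ℤ) ≡ -1 [ZMOD (4 * k)]) : J(k | N) = 1 := by
  have hodd : Odd N := by
    have h2 : (2 : ℤ) ∣ 4 * k := ⟨2 * k, by ring⟩
    rw [← Nat.not_even_iff_odd, ← Int.even_coe_nat, Int.not_even_iff_odd, Int.odd_iff]
    rcases h with h | h <;> exact h.of_dvd h2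
  have hmod : ∀ N' : ℕ, (N : ℤ) ≡ N' [ZMOD (4 * k)] → Odd N' → J(k | N) = J(k | N') :=
    fun N' h' hodd' ↦ by
      have : N % (4 * k) = N' % (4 * k) := by
        have : (N : ℤ) ≡ N' [ZMOD ((4 * k : ℕ) : ℤ)] := by exact_mod_cast h'
        exact Int.natCast_modEq_iff.1 this
      rw [jacobiSym.mod_right' k hodd, this, ← jacobiSym.mod_right' k hodd']
  rcases h with h | h
  · rw [hmod 1 (by exact_mod_cast h) odd_one, jacobiSym.one_right]
  · have hcast : ((4 * k - 1 : ℕ) : ℤ) = 4 * k - 1 := by omega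
    have hodd' : Odd (4 * k - 1) := by rw [Nat.odd_iff]; omega
    rw [hmod (4 * k - 1) (h.trans (Int.modEq_iff_dvd.2 ⟨1, by rw [hcast]; ring⟩)) hodd',
      ← one_mul (J(k | _)), ← jacobiSym.at_four hodd', ← jacobiSym.mul_left,
      jacobiSym.mod_left' (a₂ := 1) (Int.modEq_iff_dvd.2 ⟨-1, by rw [hcast]; ring⟩),
      jacobiSym.one_left, jacobiSym.at_four hodd']

lemma jacobiSym_eq_of_mul_modEq_one {k a : ℕ} {d : ℤ} (hk : 0 < k)
    (h : a * d ≡ 1 [ZMOD (4 * k)]) : J(k | a) = J(k | d.natAbs) := by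
  have hne : a * d ≠ 0 := by
    intro h0
    rw [h0] at h
    have h2 : (0 : ℤ) % 2 = 1 % 2 := h.of_dvd ⟨2 * k, by ring⟩
    norm_num at h2
  have : NeZero a := ⟨by rintro rfl; simp at hne⟩
  have : NeZero d.natAbs := ⟨by rw [Int.natAbs_ne_zero]; rintro rfl; simp at hne⟩
  refine Int.eq_of_mul_eq_one ?_
  rw [← jacobiSym.mul_right]
  refine jacobiSym_eq_one_of_modEq hk ?_
  rcases Int.natAbs_eq d with hd | hd <;> rw [hd] at h
  · left; exact_mod_cast h
  · right; simpa using h.neg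

/-- Evaluation of the quadratic Gauss sum to an even modulus. -/
theorem quadGaussSum_two_mul_modulus {k : ℕ} (hk : 0 < k) {a d : ℤ}
    (h : a * d ≡ 1 [ZMOD (4 * k)]) :
    quadGaussSum a (2 * k) =
      √(2 * k) * cexp (π * I / 4) * (gaussEps d)⁻¹ * ((J(k | d.natAbs) : ℤ) : ℂ) := by
  have h4k : (0 : ℤ) < 4 * k := by positivity
  obtain ⟨n, hn⟩ : ∃ n : ℕ, (n : ℤ) = a % (4 * k) :=
    ⟨(a % (4 * k)).toNat, by have := Int.emod_nonneg a h4k.ne'; omega⟩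
  have hna : (n : ℤ) ≡ a [ZMOD (4 * k)] := by rw [hn]; exact Int.mod_modEq _ _
  have hnd : n * d ≡ 1 [ZMOD (4 * k)] := (hna.mul_right d).trans h
  have hnd4 : ((n : ℤ) % 4) * (d % 4) % 4 = 1 := by
    rw [← Int.mul_emod]; exact hnd.of_dvd ⟨k, rfl⟩
  have hcases : (n : ℤ) % 4 = 1 ∧ d % 4 = 1 ∨ (n : ℤ) % 4 = 3 ∧ d % 4 = 3 := by
    have h1 : (n : ℤ) % 4 = 0 ∨ (n : ℤ) % 4 = 1 ∨ (n : ℤ) % 4 = 2 ∨ (n : ℤ) % 4 = 3 := by omega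
    have h2 : d % 4 = 0 ∨ d % 4 = 1 ∨ d % 4 = 2 ∨ d % 4 = 3 := by omega
    rcases h1 with h1 | h1 | h1 | h1 <;> rcases h2 with h2 | h2 | h2 | h2 <;>
      simp [h1, h2] at hnd4 ⊢
  have hodd : Odd n := by rw [Nat.odd_iff]; omega
  have heps : conj (gaussEps n) = (gaussEps d)⁻¹ := by
    rcases hcases with ⟨h1, h2⟩ | ⟨h1, h2⟩ <;> simp [gaussEps, h1, h2]
  have hcop : IsCoprime (k : ℤ) n := by
    obtain ⟨t, ht⟩ := hnd.symm.dvd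
    exact ⟨-4 * t, d, by linear_combination ht⟩
  have hn0 : (0 : ℝ) < n := by exact_mod_cast hodd.pos
  have hs : (√(((2 * k : ℕ) : ℝ) / n) : ℂ) * (√n : ℂ) = √(2 * k) := by
    rw [← ofReal_mul, ← Real.sqrt_mul (by positivity)]
    congr 2
    push_cast
    field_simp
  rw [quadGaussSum_congr (p' := n) (by
      push_cast; rw [← mul_assoc]; exact hna.symm),
    quadGaussSum_reciprocity hodd.pos (by omega) ((even_two_mul k).mul_left n),
    quadGaussSum_neg, show ((2 * k : ℕ) : ℤ) = 2 * (k : ℤ) by push_cast; rfl,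
    quadGaussSum_two_mul_eq hodd hcop, map_mul,
    map_mul, heps, jacobiSym_eq_of_mul_modEq_one hk hnd, ← hs]
  simp
  ring

lemma Finset.sum_range_mul_of_periodic {M : Type*} [AddCommMonoid M] {f : ℕ → M} {n : ℕ}
    (hf : ∀ x, f (x + n) = f x) (m : ℕ) :
    ∑ j ∈ Finset.range (m * n), f j = m • ∑ j ∈ Finset.range n, f j := by
  induction m with
  | zero => simp
  | succ m ih =>
    have h : ∀ x, f (x + m * n) = f x := fun x ↦ by
      simpa using (Function.Periodic.nsmul (f := f) (c := n) hf m) x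
    rw [add_mul, one_mul, Finset.sum_range_add, ih, succ_nsmul]
    congr 1
    exact Finset.sum_congr rfl fun x _ ↦ by rw [add_comm, h]

end GaussSum

/-- For `M` even and `γ = (a b; c d) ∈ Γ₀(2M)` with `c > 0`, the Gauss sums
`g(r) = Σ_{ℓ mod cM, ℓ≡r mod M} e^{iπaℓ²/(cM)}` vanish for `r ≢ 0 mod M`, and
`g(0) = (cM)^{1/2} e^{iπ/4} ε_d⁻¹ (2Mc/|d|)` where `(·/·)` is the Jacobi symbol and
`ε_d = 1` if `d ≡ 1 mod 4`, `ε_d = i` if `d ≡ 3 mod 4`. -/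
theorem statement17 (M : ℕ) (hM : 0 < M) (hMeven : Even M)
    (a b d : ℤ) (c : ℕ) (hc : 0 < c) (hdet : a * d - b * (c : ℤ) = 1)
    (hcong : 2 * M ∣ c)
    (g : ℤ → ℂ)
    (hg : ∀ r : ℤ, g r = ∑ j ∈ Finset.range c,
      Complex.exp (Real.pi * Complex.I * (a : ℂ) * ((r : ℂ) + (j : ℂ) * (M : ℂ)) ^ 2 /
        ((c : ℂ) * (M : ℂ)))) :
    (∀ r : ℤ, ¬ (M : ℤ) ∣ r → g r = 0) ∧
    g 0 = ((Real.sqrt (c * M) : ℝ) : ℂ) * Complex.exp (Real.pi * Complex.I / 4) *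
      (if d % 4 = 1 then (1 : ℂ) else Complex.I)⁻¹ *
      ((jacobiSym (2 * (M : ℤ) * (c : ℤ)) d.natAbs : ℤ) : ℂ) := by
  obtain ⟨k, rfl⟩ := hcong
  have hk : 0 < k := Nat.pos_of_mul_pos_left hc
  have hM' : (M : ℂ) ≠ 0 := by exact_mod_cast hM.ne'
  have hk' : (k : ℂ) ≠ 0 := by exact_mod_cast hk.ne'
  have hdet' : a * d - b * (2 * M * k) = 1 := by exact_mod_cast hdet
  refine ⟨fun r hr ↦ ?_, ?_⟩
  · set f : ℕ → ℂ := fun j ↦ cexp (Real.pi * I * a * ((r : ℂ) + (j : ℂ) * (M : ℂ)) ^ 2 /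
      (((2 * M * k : ℕ) : ℂ) * (M : ℂ))) with hf
    have hper : ∀ x, f (x + 2 * M * k) = f x := fun x ↦ by
      simp only [hf]
      rw [← mul_one (cexp (_ * (r + (x : ℂ) * M) ^ 2 / _)),
        ← cexp_pi_mul_I_mul_even (even_two_mul (a * (r + x * M + M * k * M))), ← Complex.exp_add]
      congr 1
      push_cast
      field_simp
      ring
    have hshift : ∀ x, f (x + 2 * k) = f x * cexp (2 * Real.pi * I * (a * r / M)) := fun x ↦ by
      simp only [hf]
      rw [← mul_one (_ * cexp (2 * Real.pi * I * (a * r / M))),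
        ← cexp_pi_mul_I_mul_even (even_two_mul (a * (x + k))), ← Complex.exp_add,
        ← Complex.exp_add]
      congr 1
      push_cast
      field_simp
      ring
    have hsum := Finset.sum_range_add_of_periodic hper (2 * k)
    simp only [hshift, ← Finset.sum_mul] at hsum
    rw [hg]
    by_contra hne
    have hz := (mul_eq_left₀ hne).1 hsum
    rw [Complex.exp_eq_one_iff] at hz
    obtain ⟨n, hn⟩ := hz
    have h2 : (a : ℂ) * r = n * M := by
      have := Complex.two_pi_I_ne_zero
      have h3 : (a : ℂ) * r / M = n := by
        apply mul_left_cancel₀ this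
        linear_combination hn
      rw [← h3]
      field_simp
    have h3 : a * r = n * M := by exact_mod_cast h2
    have hcop : IsCoprime (M : ℤ) a := ⟨-(b * 2 * k), d, by linear_combination hdet'⟩
    exact hr (hcop.dvd_of_dvd_mul_left ⟨n, by rw [h3]; ring⟩)
  · obtain ⟨m, rfl⟩ := hMeven
    have hmod : a * d ≡ 1 [ZMOD (4 * k)] :=
      (Int.modEq_iff_dvd.2 ⟨b * m, by push_cast at hdet'; linear_combination hdet'⟩ :
        1 ≡ a * d [ZMOD (4 * k)]).symm
    have hper : ∀ x : ℕ, cexp (Real.pi * I * a * ((x + 2 * k : ℕ) : ℂ) ^ 2 / (2 * k : ℕ)) =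
        cexp (Real.pi * I * a * (x : ℂ) ^ 2 / (2 * k : ℕ)) := fun x ↦ by
      rw [← mul_one (cexp (Real.pi * I * a * (x : ℂ) ^ 2 / _)),
        ← cexp_pi_mul_I_mul_even (even_two_mul (a * (x + k))), ← Complex.exp_add]
      congr 1
      push_cast
      field_simp
      ring
    have hgs : g 0 = ((m + m : ℕ) : ℂ) * quadGaussSum a (2 * k) := by
      rw [← nsmul_eq_mul, quadGaussSum, ← Finset.sum_range_mul_of_periodic hper, hg,
        show 2 * (m + m) * k = (m + m) * (2 * k) by ring]
      refine Finset.sum_congr rfl fun j _ ↦ ?_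
      congr 1
      have hm : (m : ℂ) ≠ 0 := by rintro h; simp [h] at hM'
      push_cast
      field_simp
      ring
    have hsqrt : √(((2 * (m + m) * k : ℕ) : ℝ) * ((m + m : ℕ) : ℝ)) =
        ((m + m : ℕ) : ℝ) * √(2 * k) := by
      rw [← Real.sqrt_sq (Nat.cast_nonneg (α := ℝ) (m + m)), ← Real.sqrt_mul (by positivity),
        Real.sqrt_sq (by positivity)]
      congr 1
      push_cast
      ring
    have hjac : jacobiSym (2 * ((m + m : ℕ) : ℤ) * ((2 * (m + m) * k : ℕ) : ℤ)) d.natAbs =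
        jacobiSym k d.natAbs := by
      have hcop : IsCoprime (2 * ((m + m : ℕ) : ℤ)) d :=
        ⟨-(b * k), a, by linear_combination hdet'⟩
      rw [show 2 * ((m + m : ℕ) : ℤ) * ((2 * (m + m) * k : ℕ) : ℤ) =
          (2 * ((m + m : ℕ) : ℤ)) ^ 2 * k by push_cast; ring, jacobiSym.mul_left,
        jacobiSym.sq_one' (by simpa [Int.gcd, Int.natAbs_abs] using
          Int.isCoprime_iff_gcd_eq_one.1 hcop), one_mul]
    rw [hgs, quadGaussSum_two_mul_modulus hk hmod, hsqrt, hjac, gaussEps]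
    push_cast
    ring
end
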